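/- arXiv:2008.12174 — 4 statements merged into one kernel-verified Lean document; each statement's English description precedes it below -/
import Mathlib

section
/- Let (F, G) be a Frobenius pair between abelian categories with enough projectives, and suppose F is faithful. If F(X) is Gorenstein projective in D, then X is Gorenstein projective in C. -/
open CategoryTheory Limits

/-- An object `M` of an abelian category is *Gorenstein projective* if it is a syzygy
(the kernel `ker(P⁰ → P¹)`) of an acyclic complex `P` of projective objects such that
`Hom(P, Q)` is acyclic for every projective `Q`. -/
def IsGorensteinProjective {A : Type*} [Category A] [Abelian A] (M : A) : Prop :=
  ∃ P : CochainComplex A ℤ,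
    (∀ n : ℤ, Projective (P.X n)) ∧
    (∀ n : ℤ, P.ExactAt n) ∧
    Nonempty (M ≅ P.cycles 0) ∧
    ∀ (Q : A), Projective Q → ∀ (n : ℤ) (f : P.X n ⟶ Q), P.d (n - 1) n ≫ f = 0 →
      ∃ g : P.X (n + 1) ⟶ Q, P.d n (n + 1) ≫ g = f

/-- `φ : X ⟶ M` is an `𝒳`-precover of `M` if `X ∈ 𝒳` and every morphism from an object
of `𝒳` to `M` factors through `φ`. -/
def IsPrecover {A : Type*} [Category A] (𝒳 : A → Prop) {X M : A} (φ : X ⟶ M) : Prop :=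
  𝒳 X ∧ ∀ (X' : A), 𝒳 X' → ∀ f : X' ⟶ M, ∃ g : X' ⟶ X, g ≫ φ = f

/-- The pair `M ⟶ P ⟶ N` is a short exact sequence. -/
structure IsShortExactPair {A : Type*} [Category A] [Abelian A] {M P N : A}
    (i : M ⟶ P) (p : P ⟶ N) : Prop where
  zero : i ≫ p = 0
  mono : Mono i
  epi : Epi p
  exists_lift : ∀ {T : A} (x : T ⟶ P), x ≫ p = 0 → ∃ y : T ⟶ M, y ≫ i = x

namespace IsShortExactPair

variable {A : Type*} [Category A] [Abelian A] {M P N : A} {i : M ⟶ P} {p : P ⟶ N}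

theorem shortExact (h : IsShortExactPair i p) : (ShortComplex.mk i p h.zero).ShortExact where
  exact := by
    have := h.mono
    refine ShortComplex.exact_of_f_is_kernel _ (KernelFork.IsLimit.ofι' i h.zero fun x hx ↦ ?_)
    exact ⟨(h.exists_lift x hx).choose, (h.exists_lift x hx).choose_spec⟩
  mono_f := h.mono
  epi_g := h.epi

theorem of_shortExact {S : ShortComplex A} (h : S.ShortExact) : IsShortExactPair S.f S.g where
  zero := S.zero
  mono := h.mono_f
  epi := h.epi_g
  exists_lift x hx := by
    have := h.mono_f
    exact ⟨h.exact.lift x hx, h.exact.lift_f x hx⟩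

theorem exists_desc (h : IsShortExactPair i p) {T : A} (x : P ⟶ T) (hx : i ≫ x = 0) :
    ∃ y : N ⟶ T, p ≫ y = x := by
  have := h.shortExact.epi_g
  exact ⟨h.shortExact.exact.desc x hx, h.shortExact.exact.g_desc x hx⟩

theorem of_mono (i : M ⟶ P) [Mono i] : IsShortExactPair i (cokernel.π i) where
  zero := cokernel.condition i
  mono := inferInstance
  epi := inferInstance
  exists_lift x hx := ⟨Abelian.monoLift i x hx, Abelian.monoLift_comp i x hx⟩

theorem of_epi (p : P ⟶ N) [Epi p] : IsShortExactPair (kernel.ι p) p where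
  zero := kernel.condition p
  mono := inferInstance
  epi := inferInstance
  exists_lift x hx := ⟨kernel.lift p x hx, kernel.lift_ι p x hx⟩

theorem map {B : Type*} [Category B] [Abelian B] (h : IsShortExactPair i p) (F : A ⥤ B)
    [F.Additive] [PreservesFiniteLimits F] [PreservesFiniteColimits F] :
    IsShortExactPair (F.map i) (F.map p) :=
  of_shortExact (h.shortExact.map_of_exact F)

theorem biprod_id_left (h : IsShortExactPair i p) (Q : A) :
    IsShortExactPair (biprod.map i (𝟙 Q)) (biprod.fst ≫ p) where
  zero := by simp [h.zero]
  mono := by have := h.mono; infer_instance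
  epi := by have := h.epi; infer_instance
  exists_lift x hx := by
    obtain ⟨y, hy⟩ := h.exists_lift (x ≫ biprod.fst) (by simpa using hx)
    exact ⟨biprod.lift y (x ≫ biprod.snd), by ext <;> simp [hy]⟩

theorem biprod_id_right (h : IsShortExactPair i p) (Q : A) :
    IsShortExactPair (i ≫ biprod.inl) (biprod.map p (𝟙 Q)) where
  zero := by ext <;> simp [h.zero]
  mono := by have := h.mono; infer_instance
  epi := by have := h.epi; infer_instance
  exists_lift x hx := by
    obtain ⟨y, hy⟩ := h.exists_lift (x ≫ biprod.fst)
      (by simpa using congr($hx ≫ biprod.fst))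
    have h0 : x ≫ biprod.snd = 0 := by simpa using congr($hx ≫ biprod.snd)
    exact ⟨y, by ext <;> simp [reassoc_of% hy, h0]⟩

theorem iso_left (h : IsShortExactPair i p) {M' : A} (e : M' ≅ M) :
    IsShortExactPair (e.hom ≫ i) p where
  zero := by simp [h.zero]
  mono := by have := h.mono; infer_instance
  epi := h.epi
  exists_lift x hx := by
    obtain ⟨y, hy⟩ := h.exists_lift x hx
    exact ⟨y ≫ e.inv, by simpa using hy⟩

theorem iso_right (h : IsShortExactPair i p) {N' : A} (e : N ≅ N') :
    IsShortExactPair i (p ≫ e.hom) where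
  zero := by simp [reassoc_of% h.zero]
  mono := h.mono
  epi := by have := h.epi; infer_instance
  exists_lift x hx := h.exists_lift x
    (by simpa [← Category.assoc, Preadditive.IsIso.comp_right_eq_zero] using hx)

/-- The Schanuel lemma. -/
theorem schanuel {M' P' : A} {i' : M' ⟶ P'} {p' : P' ⟶ N} [Projective P] [Projective P']
    (h : IsShortExactPair i p) (h' : IsShortExactPair i' p') :
    Nonempty (M ⊞ P' ≅ M' ⊞ P) := by
  have := h.epi
  have := h'.epi
  have := h.mono
  have := h'.mono
  let u : P ⟶ P' := Projective.factorThru p p'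
  let v : P' ⟶ P := Projective.factorThru p' p
  have hu : u ≫ p' = p := Projective.factorThru_comp _ _
  have hv : v ≫ p = p' := Projective.factorThru_comp _ _
  obtain ⟨s, hs⟩ := h.exists_lift (𝟙 P - u ≫ v) (by simp [hu, hv])
  obtain ⟨s', hs'⟩ := h'.exists_lift (𝟙 P' - v ≫ u) (by simp [hu, hv])
  obtain ⟨u', hu'⟩ := h'.exists_lift (i ≫ u) (by simp [hu, h.zero])
  obtain ⟨v', hv'⟩ := h.exists_lift (i' ≫ v) (by simp [hv, h'.zero])
  refine ⟨⟨biprod.desc (biprod.lift u' i) (biprod.lift s' (-v)),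
    biprod.desc (biprod.lift v' i') (biprod.lift s (-u)), ?_, ?_⟩⟩
  · ext
    · simp [← cancel_mono i, hv', hs, reassoc_of% hu']
    · simp [hu']
    · simp [← cancel_mono i, hv', hs, reassoc_of% hs']
    · simp [hs']
  · ext
    · simp [← cancel_mono i', hu', hs', reassoc_of% hv']
    · simp [hv']
    · simp [← cancel_mono i', hu', hs', reassoc_of% hs]
    · simp [hs]

/-- The dual of the Schanuel lemma, for two monomorphisms extending along each other. -/
theorem schanuel_of_extends {P' N' : A} {i' : M ⟶ P'} {p' : P' ⟶ N'}
    (h : IsShortExactPair i p) (h' : IsShortExactPair i' p')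
    {u : P ⟶ P'} (hu : i ≫ u = i') {v : P' ⟶ P} (hv : i' ≫ v = i) :
    Nonempty (N ⊞ P' ≅ N' ⊞ P) := by
  have := h.epi
  have := h'.epi
  obtain ⟨s, hs⟩ := h.exists_desc (𝟙 P - u ≫ v) (by simp [reassoc_of% hu, hv])
  obtain ⟨s', hs'⟩ := h'.exists_desc (𝟙 P' - v ≫ u) (by simp [reassoc_of% hv, hu])
  obtain ⟨u', hu'⟩ := h.exists_desc (u ≫ p') (by simp [reassoc_of% hu, h'.zero])
  obtain ⟨v', hv'⟩ := h'.exists_desc (v ≫ p) (by simp [reassoc_of% hv, h.zero])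
  refine ⟨⟨biprod.desc (biprod.lift u' s) (biprod.lift p' (-v)),
    biprod.desc (biprod.lift v' s') (biprod.lift p (-u)), ?_, ?_⟩⟩
  · ext
    · simp [← cancel_epi p, hv', reassoc_of% hs, reassoc_of% hu']
    · simp [← cancel_epi p, reassoc_of% hs, reassoc_of% hu', hs']
    · simp [hv']
    · simp [hs']
  · ext
    · simp [← cancel_epi p', hu', reassoc_of% hs', reassoc_of% hv']
    · simp [← cancel_epi p', reassoc_of% hs', reassoc_of% hv', hs]
    · simp [hu']
    · simp [hs]

end IsShortExactPair

/-- `M ⟶ P ⟶ N` is a short exact sequence with `P` projective, and every morphism from `M` to a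
projective object extends to `P`. -/
structure IsCosyzygyPair {A : Type*} [Category A] [Abelian A] {M P N : A}
    (i : M ⟶ P) (p : P ⟶ N) : Prop extends IsShortExactPair i p where
  projective : Projective P
  exists_extension : ∀ {Q : A}, Projective Q → ∀ f : M ⟶ Q, ∃ g : P ⟶ Q, i ≫ g = f

namespace IsCosyzygyPair

variable {A : Type*} [Category A] [Abelian A] {M P N : A} {i : M ⟶ P} {p : P ⟶ N}

theorem biprod_id_left (h : IsCosyzygyPair i p) (Q : A) [Projective Q] :
    IsCosyzygyPair (biprod.map i (𝟙 Q)) (biprod.fst ≫ p) where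
  toIsShortExactPair := h.toIsShortExactPair.biprod_id_left Q
  projective := by have := h.projective; infer_instance
  exists_extension hR f := by
    obtain ⟨g, hg⟩ := h.exists_extension hR (biprod.inl ≫ f)
    exact ⟨biprod.desc g (biprod.inr ≫ f), by ext <;> simp [hg]⟩

theorem biprod_id_right (h : IsCosyzygyPair i p) (Q : A) [Projective Q] :
    IsCosyzygyPair (i ≫ biprod.inl) (biprod.map p (𝟙 Q)) where
  toIsShortExactPair := h.toIsShortExactPair.biprod_id_right Q
  projective := by have := h.projective; infer_instance
  exists_extension hR f := by
    obtain ⟨g, hg⟩ := h.exists_extension hR f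
    exact ⟨biprod.desc g 0, by simp [hg]⟩

theorem iso_left (h : IsCosyzygyPair i p) {M' : A} (e : M' ≅ M) :
    IsCosyzygyPair (e.hom ≫ i) p where
  toIsShortExactPair := h.toIsShortExactPair.iso_left e
  projective := h.projective
  exists_extension hR f := by
    obtain ⟨g, hg⟩ := h.exists_extension hR (e.inv ≫ f)
    exact ⟨g, by simp [hg]⟩

theorem iso_right (h : IsCosyzygyPair i p) {N' : A} (e : N ≅ N') :
    IsCosyzygyPair i (p ≫ e.hom) where
  toIsShortExactPair := h.toIsShortExactPair.iso_right e
  projective := h.projective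
  exists_extension := h.exists_extension

/-- If `N` is a cosyzygy, then morphisms to projective objects extend along every monomorphism
with cokernel `N`. -/
theorem exists_extension_of_shortExact (h : IsCosyzygyPair i p) {K B : A} {k : K ⟶ B} {q : B ⟶ N}
    (hk : IsShortExactPair k q) {Q : A} (hQ : Projective Q) (f : K ⟶ Q) :
    ∃ g : B ⟶ Q, k ≫ g = f := by
  have := h.projective
  have := h.epi
  have := hk.epi
  have := hk.mono
  let t : P ⟶ B := Projective.factorThru p q
  have ht : t ≫ q = p := Projective.factorThru_comp _ _
  obtain ⟨a, ha⟩ := hk.exists_lift (i ≫ t) (by simp [ht, h.zero])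
  obtain ⟨b, hb⟩ := h.exists_extension hQ (a ≫ f)
  let e : K ⊞ P ⟶ B := biprod.desc k t
  have : Epi e := by
    refine Preadditive.epi_of_cancel_zero _ fun x hx ↦ ?_
    have hkx : k ≫ x = 0 := by simpa [e] using congr(biprod.inl ≫ $hx)
    have htx : t ≫ x = 0 := by simpa [e] using congr(biprod.inr ≫ $hx)
    obtain ⟨y, rfl⟩ := hk.exists_desc x hkx
    rw [reassoc_of% ht] at htx
    rw [zero_of_epi_comp p htx, comp_zero]
  have hf : kernel.ι e ≫ biprod.desc f b = 0 := by
    have he : (kernel.ι e ≫ biprod.fst) ≫ k + (kernel.ι e ≫ biprod.snd) ≫ t = 0 := by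
      simpa [e, biprod.desc_eq] using kernel.condition e
    obtain ⟨y, hy⟩ := h.exists_lift (kernel.ι e ≫ biprod.snd) (by
      simpa [ht, hk.zero] using congr($he ≫ q))
    have hy' : kernel.ι e ≫ biprod.fst = -(y ≫ a) := by
      rw [← cancel_mono k, Preadditive.neg_comp, Category.assoc y, ha, reassoc_of% hy]
      exact eq_neg_of_add_eq_zero_left (by simpa using he)
    rw [biprod.desc_eq, Preadditive.comp_add, reassoc_of% hy', ← reassoc_of% hy]
    simp [hb]
  refine ⟨Abelian.epiDesc e (biprod.desc f b) hf, ?_⟩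
  rw [← biprod.inl_desc k t, Category.assoc, Abelian.comp_epiDesc e, biprod.inl_desc]

end IsCosyzygyPair

/-- `N` is the cokernel of a monomorphism from `M` to a projective object along which all
morphisms from `M` to projective objects extend. -/
def IsCosyzygy {A : Type*} [Category A] [Abelian A] (M N : A) : Prop :=
  ∃ (P : A) (i : M ⟶ P) (p : P ⟶ N), IsCosyzygyPair i p

namespace IsCosyzygy

variable {A : Type*} [Category A] [Abelian A] {M N : A}

theorem biprod_left (h : IsCosyzygy M N) (Q : A) [Projective Q] : IsCosyzygy (M ⊞ Q) N :=
  let ⟨_, _, _, hp⟩ := h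
  ⟨_, _, _, hp.biprod_id_left Q⟩

theorem biprod_right (h : IsCosyzygy M N) (Q : A) [Projective Q] : IsCosyzygy M (N ⊞ Q) :=
  let ⟨_, _, _, hp⟩ := h
  ⟨_, _, _, hp.biprod_id_right Q⟩

theorem of_iso_left (h : IsCosyzygy M N) {M' : A} (e : M' ≅ M) : IsCosyzygy M' N :=
  let ⟨_, _, _, hp⟩ := h
  ⟨_, _, _, hp.iso_left e⟩

theorem of_iso_right (h : IsCosyzygy M N) {N' : A} (e : N ≅ N') : IsCosyzygy M N' :=
  let ⟨_, _, _, hp⟩ := h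
  ⟨_, _, _, hp.iso_right e⟩

end IsCosyzygy

/-- Every object satisfying `S` has a cosyzygy satisfying `S` and is a cosyzygy of an object
satisfying `S`. -/
structure IsCosyzygyStable {A : Type*} [Category A] [Abelian A] (S : A → Prop) : Prop where
  exists_right : ∀ {M : A}, S M → ∃ N, S N ∧ IsCosyzygy M N
  exists_left : ∀ {M : A}, S M → ∃ N, S N ∧ IsCosyzygy N M

namespace IsCosyzygyStable

variable {A : Type*} [Category A] [Abelian A] {S : A → Prop}

theorem exists_sequence (hS : IsCosyzygyStable S) {M : A} (hM : S M) :
    ∃ Z : ℤ → A, Z 0 = M ∧ ∀ n, IsCosyzygy (Z n) (Z (n + 1)) := by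
  have hr (T : {T // S T}) : ∃ T' : {T // S T}, IsCosyzygy T.1 T'.1 :=
    let ⟨N, hN, h⟩ := hS.exists_right T.2
    ⟨⟨N, hN⟩, h⟩
  have hl (T : {T // S T}) : ∃ T' : {T // S T}, IsCosyzygy T'.1 T.1 :=
    let ⟨N, hN, h⟩ := hS.exists_left T.2
    ⟨⟨N, hN⟩, h⟩
  choose r hr using hr
  choose l hl using hl
  let Z : ℤ → A
    | .ofNat k => (r^[k] ⟨M, hM⟩).1
    | .negSucc k => (l^[k + 1] ⟨M, hM⟩).1
  refine ⟨Z, rfl, fun n ↦ ?_⟩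
  match n with
  | .ofNat k =>
    change IsCosyzygy (r^[k] ⟨M, hM⟩).1 (r^[k + 1] ⟨M, hM⟩).1
    rw [Function.iterate_succ_apply']
    exact hr _
  | .negSucc 0 => exact hl _
  | .negSucc (k + 1) =>
    change IsCosyzygy (l^[k + 2] ⟨M, hM⟩).1 (l^[k + 1] ⟨M, hM⟩).1
    rw [Function.iterate_succ_apply' l (k + 1)]
    exact hl _

theorem isGorensteinProjective (hS : IsCosyzygyStable S) {M : A} (hM : S M) :
    IsGorensteinProjective M := by
  obtain ⟨Z, rfl, hZ⟩ := hS.exists_sequence hM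
  choose X i p h using hZ
  let d (n : ℤ) : X n ⟶ X (n + 1) := p n ≫ i (n + 1)
  have hd (n : ℤ) : d n ≫ d (n + 1) = 0 := by
    simp [d, reassoc_of% (h (n + 1)).zero]
  let P : CochainComplex A ℤ := CochainComplex.of X d hd
  have hP (n : ℤ) : P.d n (n + 1) = p n ≫ i (n + 1) := CochainComplex.of_d X d n
  have hex (n : ℤ) : P.ExactAt (n + 1) := by
    rw [P.exactAt_iff' n (n + 1) (n + 1 + 1) (by simp) (by simp),
      ShortComplex.exact_iff_exact_up_to_refinements]
    intro T (x : T ⟶ X (n + 1)) (hx : x ≫ P.d (n + 1) (n + 1 + 1) = 0)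
    have := (h (n + 1 + 1)).mono
    have := (h n).epi
    rw [hP, ← Category.assoc] at hx
    obtain ⟨y, rfl⟩ := (h (n + 1)).exists_lift x (zero_of_comp_mono _ hx)
    obtain ⟨T', π, hπ, z, hz⟩ := surjective_up_to_refinements_of_epi (p n) y
    refine ⟨T', π, hπ, z, ?_⟩
    change π ≫ y ≫ i (n + 1) = z ≫ P.d n (n + 1)
    rw [hP, reassoc_of% hz]
  have hker (n : ℤ) : i n ≫ P.d n (n + 1) = 0 := by simp [hP, reassoc_of% (h n).zero]
  have hcyc : Nonempty (Z 0 ≅ P.cycles 0) := by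
    have := (h 0).mono
    have := (h (0 + 1)).mono
    have hlim : IsLimit (KernelFork.ofι (i 0) (hker 0)) :=
      KernelFork.IsLimit.ofι' (i 0) (hker 0) fun x hx ↦ by
        rw [hP, ← Category.assoc] at hx
        have hy := (h 0).exists_lift x (zero_of_comp_mono _ hx)
        exact ⟨hy.choose, hy.choose_spec⟩
    exact ⟨hlim.conePointUniqueUpToIso (P.cyclesIsKernel 0 (0 + 1) (by simp))⟩
  refine ⟨P, fun n ↦ (h n).projective, fun n ↦ ?_, hcyc, fun Q hQ n f hf ↦ ?_⟩
  all_goals obtain ⟨n, rfl⟩ : ∃ m, n = m + 1 := ⟨n - 1, by simp⟩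
  · exact hex n
  · rw [add_sub_cancel_right, hP, Category.assoc] at hf
    have := (h n).epi
    obtain ⟨f', rfl⟩ := (h (n + 1)).exists_desc f (zero_of_epi_comp _ hf)
    obtain ⟨g, rfl⟩ := (h (n + 1 + 1)).exists_extension hQ f'
    exact ⟨g, by rw [hP, Category.assoc]⟩

end IsCosyzygyStable

namespace IsGorensteinProjective

variable {A : Type*} [Category A] [Abelian A] {M : A}

theorem exists_isCosyzygyStable (h : IsGorensteinProjective M) :
    ∃ S : A → Prop, IsCosyzygyStable S ∧ S M := by
  obtain ⟨P, hproj, hexact, ⟨e⟩, hext⟩ := h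
  have hepi (n : ℤ) : Epi (P.toCycles n (n + 1)) := by
    exact Preadditive.epi_of_isZero_cokernel' _ (P.homologyIsCokernel n (n + 1) (by simp))
      (hexact (n + 1)).isZero_homology
  have hpair (n : ℤ) : IsCosyzygy (P.cycles n) (P.cycles (n + 1)) := by
    refine ⟨P.X n, P.iCycles n, P.toCycles n (n + 1), ⟨by simp [← cancel_mono (P.iCycles (n + 1))],
      inferInstance, hepi n, fun x hx ↦ ?_⟩, hproj n, fun {Q} hQ f ↦ ?_⟩
    · exact ⟨P.liftCycles x (n + 1) (by simp) (by
        rw [← P.toCycles_i, reassoc_of% hx, zero_comp]), by simp⟩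
    · obtain ⟨n, rfl⟩ : ∃ m, n = m + 1 := ⟨n - 1, by simp⟩
      obtain ⟨g, hg⟩ := hext Q hQ n (P.toCycles n (n + 1) ≫ f) (by simp)
      have := hepi n
      refine ⟨g, ?_⟩
      rw [← cancel_epi (P.toCycles n (n + 1)), ← hg, ← P.toCycles_i, Category.assoc]
  refine ⟨fun N ↦ ∃ n, Nonempty (N ≅ P.cycles n), ⟨?_, ?_⟩, 0, ⟨e⟩⟩
  · rintro N ⟨n, ⟨e⟩⟩
    exact ⟨_, ⟨n + 1, ⟨Iso.refl _⟩⟩, (hpair n).of_iso_left e⟩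
  · rintro N ⟨n, ⟨e⟩⟩
    obtain ⟨n, rfl⟩ : ∃ m, n = m + 1 := ⟨n - 1, by simp⟩
    exact ⟨_, ⟨n, ⟨Iso.refl _⟩⟩, (hpair n).of_iso_right e.symm⟩

theorem isCosyzygyStable : IsCosyzygyStable (IsGorensteinProjective (A := A)) where
  exists_right hM := by
    obtain ⟨S, hS, hM⟩ := hM.exists_isCosyzygyStable
    obtain ⟨N, hN, h⟩ := hS.exists_right hM
    exact ⟨N, hS.isGorensteinProjective hN, h⟩
  exists_left hM := by
    obtain ⟨S, hS, hM⟩ := hM.exists_isCosyzygyStable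
    obtain ⟨N, hN, h⟩ := hS.exists_left hM
    exact ⟨N, hS.isGorensteinProjective hN, h⟩

theorem of_neighbors {L N : A} (hL : IsGorensteinProjective L) (hN : IsGorensteinProjective N)
    (hLM : IsCosyzygy L M) (hMN : IsCosyzygy M N) : IsGorensteinProjective M := by
  have hS : IsCosyzygyStable fun K : A ↦ IsGorensteinProjective K ∨ K = M :=
    { exists_right := by
        rintro K (hK | rfl)
        · obtain ⟨N, hN, h⟩ := isCosyzygyStable.exists_right hK
          exact ⟨N, .inl hN, h⟩
        · exact ⟨N, .inl hN, hMN⟩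
      exists_left := by
        rintro K (hK | rfl)
        · obtain ⟨N, hN, h⟩ := isCosyzygyStable.exists_left hK
          exact ⟨N, .inl hN, h⟩
        · exact ⟨L, .inl hL, hLM⟩ }
  exact hS.isGorensteinProjective (.inr rfl)

theorem of_iso (h : IsGorensteinProjective M) {M' : A} (e : M ≅ M') :
    IsGorensteinProjective M' :=
  let ⟨P, hproj, hexact, ⟨e'⟩, hext⟩ := h
  ⟨P, hproj, hexact, ⟨e.symm ≪≫ e'⟩, hext⟩

theorem biprod (h : IsGorensteinProjective M) (Q : A) [Projective Q] :
    IsGorensteinProjective (M ⊞ Q) :=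
  let ⟨_, hN, hMN⟩ := isCosyzygyStable.exists_right h
  let ⟨_, hL, hLM⟩ := isCosyzygyStable.exists_left h
  of_neighbors hL hN (hLM.biprod_right Q) (hMN.biprod_left Q)

end IsGorensteinProjective

/-- `M` becomes Gorenstein projective after adding a projective direct summand. -/
def IsStablyGorensteinProjective {A : Type*} [Category A] [Abelian A] (M : A) : Prop :=
  ∃ Q : A, Projective Q ∧ IsGorensteinProjective (M ⊞ Q)

namespace IsStablyGorensteinProjective

variable {A : Type*} [Category A] [Abelian A] {M : A}

theorem exists_isCosyzygyPair (h : IsStablyGorensteinProjective M) :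
    ∃ (P N : A) (i : M ⟶ P) (p : P ⟶ N), IsCosyzygyPair i p := by
  obtain ⟨Q, hQ, hM⟩ := h
  obtain ⟨N, -, P, i, p, hip⟩ := IsGorensteinProjective.isCosyzygyStable.exists_right hM
  have := hip.mono
  refine ⟨P, _, biprod.inl ≫ i, _, .of_mono _, hip.projective, fun hR f ↦ ?_⟩
  obtain ⟨g, hg⟩ := hip.exists_extension hR (biprod.desc f 0)
  exact ⟨g, by simp [hg]⟩

theorem of_isCosyzygyPair (h : IsStablyGorensteinProjective M) {P N : A} {i : M ⟶ P} {p : P ⟶ N}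
    (hip : IsCosyzygyPair i p) : IsStablyGorensteinProjective N := by
  obtain ⟨Q, hQ, hM⟩ := h
  obtain ⟨N', hN', P', i', p', hip'⟩ := IsGorensteinProjective.isCosyzygyStable.exists_right hM
  have hipQ := hip.biprod_id_left Q
  obtain ⟨u, hu⟩ := hip'.exists_extension hipQ.projective (biprod.map i (𝟙 Q))
  obtain ⟨v, hv⟩ := hipQ.exists_extension hip'.projective i'
  obtain ⟨e⟩ := hip'.toIsShortExactPair.schanuel_of_extends hipQ.toIsShortExactPair hu hv
  have := hipQ.projective
  exact ⟨P', hip'.projective, (hN'.biprod _).of_iso e⟩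

theorem isCosyzygyPair_of_shortExact (h : IsStablyGorensteinProjective M) {K P : A} {k : K ⟶ P}
    {p : P ⟶ M} [Projective P] (hkp : IsShortExactPair k p) : IsCosyzygyPair k p := by
  obtain ⟨Q, hQ, hM⟩ := h
  obtain ⟨L, -, R, i, q, hiq⟩ := IsGorensteinProjective.isCosyzygyStable.exists_left hM
  refine ⟨hkp, inferInstance, fun hR f ↦ ?_⟩
  obtain ⟨g, hg⟩ := hiq.exists_extension_of_shortExact (hkp.biprod_id_right Q) hR f
  exact ⟨biprod.inl ≫ g, by simpa using hg⟩

theorem of_shortExact (h : IsStablyGorensteinProjective M) {K P : A} {k : K ⟶ P}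
    {p : P ⟶ M} [Projective P] (hkp : IsShortExactPair k p) :
    IsStablyGorensteinProjective K := by
  obtain ⟨Q, hQ, hM⟩ := h
  obtain ⟨L, hL, R, i, q, hiq⟩ := IsGorensteinProjective.isCosyzygyStable.exists_left hM
  have := hiq.projective
  obtain ⟨e⟩ := hiq.toIsShortExactPair.schanuel (hkp.biprod_id_right Q)
  exact ⟨R, inferInstance, (hL.biprod _).of_iso e⟩

end IsStablyGorensteinProjective

open scoped ZeroObject in
theorem IsGorensteinProjective.isStablyGorensteinProjective {A : Type*} [Category A] [Abelian A]
    {M : A} (h : IsGorensteinProjective M) : IsStablyGorensteinProjective M :=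
  ⟨0, inferInstance, h.biprod 0⟩

section Frobenius

variable {C D : Type*} [Category C] [Category D] {F : C ⥤ D} {G : D ⥤ C}

/-- Let `F ⊣ G ⊣ F` with `F` faithful. If morphisms from `F.obj K` to projective objects extend
along `j : F.obj K ⟶ R`, then morphisms from `K` to projective objects extend along the transpose
`K ⟶ G.obj R`. -/
theorem exists_extension_homEquiv (adj₁ : F ⊣ G) (adj₂ : G ⊣ F) [F.Faithful] {K : C} {R : D}
    (j : F.obj K ⟶ R)
    (hj : ∀ {Q : D}, Projective Q → ∀ f : F.obj K ⟶ Q, ∃ g : R ⟶ Q, j ≫ g = f)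
    {Q : C} (hQ : Projective Q) (f : K ⟶ Q) :
    ∃ g : G.obj R ⟶ Q, adj₁.homEquiv _ _ j ≫ g = f := by
  have := adj₁.isLeftAdjoint
  have := adj₂.isLeftAdjoint
  let s : Q ⟶ G.obj (F.obj Q) := Projective.factorThru (𝟙 Q) (adj₂.counit.app Q)
  have hs : s ≫ adj₂.counit.app Q = 𝟙 Q := Projective.factorThru_comp _ _
  obtain ⟨g, hg⟩ := hj (adj₁.map_projective Q hQ) ((adj₁.homEquiv _ _).symm (f ≫ s))
  refine ⟨G.map g ≫ adj₂.counit.app Q, ?_⟩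
  rw [← Category.assoc, ← adj₁.homEquiv_naturality_right, hg, Equiv.apply_symm_apply,
    Category.assoc, hs, Category.comp_id]

/-- Objects whose image under a faithful Frobenius functor is stably Gorenstein projective are
stable under syzygies and cosyzygies. -/
theorem isCosyzygyStable_of_frobenius [Abelian C] [Abelian D] [EnoughProjectives C] [F.Additive] [G.Additive]
    (adj₁ : F ⊣ G) (adj₂ : G ⊣ F) [F.Faithful] :
    IsCosyzygyStable fun Y : C ↦ IsStablyGorensteinProjective (F.obj Y) := by
  have := adj₁.isLeftAdjoint
  have := adj₂.isLeftAdjoint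
  have := adj₁.isRightAdjoint
  have := adj₂.isRightAdjoint
  have hF {Q : C} (hQ : Projective Q) : Projective (F.obj Q) := adj₁.map_projective Q hQ
  have hG {Q : D} (hQ : Projective Q) : Projective (G.obj Q) := adj₂.map_projective Q hQ
  refine ⟨fun {Y} hY ↦ ?_, fun {Y} hY ↦ ?_⟩
  · obtain ⟨R, N, j, p, hjp⟩ := hY.exists_isCosyzygyPair
    have := hjp.mono
    let i : Y ⟶ G.obj R := adj₁.homEquiv _ _ j
    have : Mono i := by
      rw [show i = _ from adj₁.homEquiv_unit _ _ _]
      infer_instance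
    have hi : IsCosyzygyPair i (cokernel.π i) :=
      { toIsShortExactPair := .of_mono i
        projective := hG hjp.projective
        exists_extension := exists_extension_homEquiv adj₁ adj₂ j hjp.exists_extension }
    refine ⟨_, hY.of_isCosyzygyPair ⟨hi.toIsShortExactPair.map F, hF hi.projective, ?_⟩,
      _, _, _, hi⟩
    intro Q hQ f
    obtain ⟨g, rfl⟩ := hjp.exists_extension hQ f
    have hij : F.map i ≫ adj₁.counit.app R = j :=
      (adj₁.homEquiv_counit _ _ _).symm.trans (Equiv.symm_apply_apply _ _)
    exact ⟨adj₁.counit.app R ≫ g, by rw [reassoc_of% hij]⟩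
  · obtain ⟨⟨P, π⟩⟩ := EnoughProjectives.presentation Y
    have hp := IsShortExactPair.of_epi π
    have : Projective (F.obj P) := hF inferInstance
    have hFp := hY.isCosyzygyPair_of_shortExact (hp.map F)
    refine ⟨_, hY.of_shortExact (hp.map F), _, _, _, hp, inferInstance, fun hQ f ↦ ?_⟩
    obtain ⟨g, hg⟩ := exists_extension_homEquiv adj₁ adj₂ _ hFp.exists_extension hQ f
    refine ⟨adj₁.unit.app _ ≫ g, ?_⟩
    rw [← hg, adj₁.homEquiv_unit, adj₁.unit_naturality, Category.assoc]

end Frobenius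

/-- If `(F, G)` is a Frobenius pair between abelian categories with enough projectives,
`F` is faithful and `F X` is Gorenstein projective in `D`, then `X` is Gorenstein
projective in `C`. -/
theorem gorensteinProjective_of_map_frobenius {C D : Type*} [Category C] [Category D]
    [Abelian C] [Abelian D] [EnoughProjectives C] [EnoughProjectives D]
    (F : C ⥤ D) (G : D ⥤ C) [F.Additive] [G.Additive]
    (adj₁ : F ⊣ G) (adj₂ : G ⊣ F) [F.Faithful]
    (X : C) (hX : IsGorensteinProjective (F.obj X)) :
    IsGorensteinProjective X := by
  exact (isCosyzygyStable_of_frobenius adj₁ adj₂).isGorensteinProjective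
    hX.isStablyGorensteinProjective
end

section
/- Let (F, G) be a Frobenius pair between abelian categories with enough projectives, and suppose the unit η_X : X ⟶ G(F(X)) is such that F(η_X) is a split monomorphism. If X embeds in G(F(X)) via η_X with cokernel K, and G(F(X)) fits in a short exact sequence 0 → G(F(X)) → P⁰ → L¹ → 0 with P⁰ projective and L¹ Gorenstein projective, then in the pushout short exact sequence 0 → X → P⁰ → H¹ → 0, the object F(H¹) is Gorenstein projective in D. -/
open CategoryTheory Limits

universe w v u

section

variable {A : Type u} [Category.{v} A] [Abelian A]

/-- A two-sided sequence of short exact sequences `0 ⟶ Z n ⟶ X n ⟶ Z (n + 1) ⟶ 0` with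
projective middle terms, whose monomorphisms have the extension property with respect to
projective objects. -/
structure TotalSyzygies (A : Type u) [Category.{v} A] [Abelian A] where
  /-- The syzygies. -/
  Z : ℤ → A
  /-- The projective middle terms. -/
  X : ℤ → A
  /-- The inclusions of the syzygies. -/
  ι : ∀ n, Z n ⟶ X n
  /-- The projections onto the next syzygies. -/
  π : ∀ n, X n ⟶ Z (n + 1)
  w : ∀ n, ι n ≫ π n = 0
  projective : ∀ n, Projective (X n)
  shortExact : ∀ n, (ShortComplex.mk (ι n) (π n) (w n)).ShortExact
  extend : ∀ (Q : A), Projective Q → ∀ (n : ℤ) (f : Z n ⟶ Q), ∃ g : X n ⟶ Q, ι n ≫ g = f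

lemma IsGorensteinProjective.exists_totalSyzygies {M : A} (hM : IsGorensteinProjective M) :
    ∃ T : TotalSyzygies A, Nonempty (M ≅ T.Z 0) := by
  obtain ⟨P, hP, hex, hiso, hQ⟩ := hM
  have hepi (n : ℤ) : Epi (P.toCycles n (n + 1)) := by
    have h := (P.exactAt_iff' n (n + 1) (n + 1 + 1) (by simp) (by simp)).1 (hex (n + 1))
    rw [epi_iff_surjective_up_to_refinements]
    intro B y
    have hy : (y ≫ P.iCycles (n + 1)) ≫ P.d (n + 1) (n + 1 + 1) = 0 := by simp
    obtain ⟨B', π, hπ, x, hx⟩ := h.exact_up_to_refinements (y ≫ P.iCycles (n + 1)) hy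
    change B' ⟶ P.X n at x
    refine ⟨B', π, hπ, x, ?_⟩
    rw [← cancel_mono (P.iCycles (n + 1)), Category.assoc, Category.assoc, P.toCycles_i]
    exact hx
  refine ⟨⟨fun n => P.cycles n, P.X, fun n => P.iCycles n, fun n => P.toCycles n (n + 1), ?_, hP,
    ?_, ?_⟩, hiso⟩
  · intro n
    rw [← cancel_mono (P.iCycles (n + 1))]
    simp
  · intro n
    have := hepi n
    refine { exact := ?_, mono_f := by dsimp; infer_instance, epi_g := this }
    rw [ShortComplex.exact_iff_exact_up_to_refinements]
    intro B x hx
    have hx' : x ≫ P.d n (n + 1) = 0 := by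
      have h := congrArg (· ≫ P.iCycles (n + 1)) hx
      simpa using h
    exact ⟨B, 𝟙 B, inferInstance, P.liftCycles x (n + 1) (by simp) hx', by simp⟩
  · intro Q hQp n f
    obtain ⟨m, rfl⟩ : ∃ m, n = m + 1 := ⟨n - 1, by lia⟩
    obtain ⟨g, hg⟩ := hQ Q hQp m (P.toCycles m (m + 1) ≫ f) (by simp [← Category.assoc])
    have := hepi m
    refine ⟨g, ?_⟩
    rw [← cancel_epi (P.toCycles m (m + 1))]
    simpa using hg

lemma TotalSyzygies.isGorensteinProjective (T : TotalSyzygies A) {M : A} (e : M ≅ T.Z 0) :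
    IsGorensteinProjective M := by
  have hm (n : ℤ) : Mono (T.ι n) := (T.shortExact n).mono_f
  have he (n : ℤ) : Epi (T.π n) := (T.shortExact n).epi_g
  let P : CochainComplex A ℤ := CochainComplex.of T.X (fun n => T.π n ≫ T.ι (n + 1)) (by
    intro n
    simp [reassoc_of% T.w (n + 1)])
  have hd (n : ℤ) : P.d n (n + 1) = T.π n ≫ T.ι (n + 1) :=
    CochainComplex.of_d T.X (fun n => T.π n ≫ T.ι (n + 1)) n
  have hlift (n : ℤ) {B : A} (x : B ⟶ T.X n) (hx : x ≫ P.d n (n + 1) = 0) :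
      ∃ y : B ⟶ T.Z n, y ≫ T.ι n = x := by
    have hx' : x ≫ T.π n = 0 := by
      rw [hd, ← Category.assoc] at hx
      exact zero_of_comp_mono _ hx
    exact ⟨(T.shortExact n).exact.lift x hx', (T.shortExact n).exact.lift_f x hx'⟩
  refine ⟨P, T.projective, ?_, ?_, ?_⟩
  · intro n
    obtain ⟨m, rfl⟩ : ∃ m, n = m + 1 := ⟨n - 1, by lia⟩
    rw [P.exactAt_iff' m (m + 1) (m + 1 + 1) (by simp) (by simp),
      ShortComplex.exact_iff_exact_up_to_refinements]
    intro B x hx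
    change B ⟶ T.X (m + 1) at x
    obtain ⟨y, hy⟩ := hlift (m + 1) x hx
    obtain ⟨B', π, hπ, z, hz⟩ := surjective_up_to_refinements_of_epi (T.π m) y
    refine ⟨B', π, hπ, z, ?_⟩
    change π ≫ x = z ≫ P.d m (m + 1)
    rw [hd, ← reassoc_of% hz, hy]
  · have h0 : T.ι 0 ≫ P.d 0 (0 + 1) = 0 := by
      rw [hd, reassoc_of% T.w 0, zero_comp]
    obtain ⟨y, hy⟩ := hlift 0 (P.iCycles 0) (by simp)
    refine ⟨e ≪≫ ⟨P.liftCycles (T.ι 0) (0 + 1) (by simp) h0, y, ?_, ?_⟩⟩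
    · rw [← cancel_mono (T.ι 0)]
      simp [hy]
    · rw [← cancel_mono (P.iCycles 0)]
      simp [hy]
  · intro Q hQ n f hf
    obtain ⟨m, rfl⟩ : ∃ m, n = m + 1 := ⟨n - 1, by lia⟩
    have hk (k : ℤ) (h : k = m + 1 - 1) : P.d k (m + 1) ≫ f = 0 := by
      subst h
      exact hf
    have hf' : T.ι (m + 1) ≫ f = 0 := by
      rw [← cancel_epi (T.π m), comp_zero, ← Category.assoc, ← hd]
      exact hk m (by lia)
    obtain ⟨g, hg⟩ := T.extend Q hQ _ ((T.shortExact (m + 1)).exact.desc f hf')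
    refine ⟨g, ?_⟩
    rw [hd, Category.assoc, hg]
    exact (T.shortExact (m + 1)).exact.g_desc f hf'

/-- The cokernel sequence of a horseshoe diagram. -/
lemma exists_shortExact_cokernel_of_extension {S SA SB : ShortComplex A} (hS : S.ShortExact)
    (hA : SA.ShortExact) (hB : SB.ShortExact) (eA : S.X₁ ≅ SA.X₁) (eB : S.X₃ ≅ SB.X₁)
    (e : S.X₂ ⟶ SA.X₂) (he : S.f ≫ e = eA.hom ≫ SA.f) :
    Mono (biprod.lift e (S.g ≫ eB.hom ≫ SB.f)) ∧
      ∃ (j : SA.X₃ ⟶ cokernel (biprod.lift e (S.g ≫ eB.hom ≫ SB.f)))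
        (r : cokernel (biprod.lift e (S.g ≫ eB.hom ≫ SB.f)) ⟶ SB.X₃) (h : j ≫ r = 0),
        (ShortComplex.mk j r h).ShortExact := by
  have := hS.mono_f
  have := hS.epi_g
  have := hA.mono_f
  have := hA.epi_g
  have := hB.mono_f
  have := hB.epi_g
  set m := biprod.lift e (S.g ≫ eB.hom ≫ SB.f) with hm
  have hfm : S.f ≫ m = eA.hom ≫ SA.f ≫ biprod.inl := by
    ext <;> simp [hm, he]
  have hker {B : A} (z : B ⟶ S.X₂) (hz : z ≫ m ≫ biprod.snd = 0) :
      ∃ y : B ⟶ S.X₁, y ≫ S.f = z := by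
    have hz' : z ≫ S.g = 0 := by
      rw [← cancel_mono (eB.hom ≫ SB.f), zero_comp]
      simpa [hm] using hz
    exact ⟨hS.exact.lift z hz', hS.exact.lift_f z hz'⟩
  have hmono : Mono m := by
    refine Preadditive.mono_of_cancel_zero _ fun {B} x hx => ?_
    obtain ⟨y, rfl⟩ := hker x (by rw [reassoc_of% hx, zero_comp])
    rw [Category.assoc, hfm, ← Category.assoc, ← Category.assoc] at hx
    have h1 := zero_of_comp_mono _ (zero_of_comp_mono _ hx)
    rw [zero_of_comp_mono _ h1, zero_comp]
  have hj : SA.f ≫ biprod.inl ≫ cokernel.π m = 0 := by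
    rw [← cancel_epi eA.hom, ← Category.assoc SA.f, ← Category.assoc, ← hfm]
    simp
  have hr : m ≫ biprod.snd ≫ SB.g = 0 := by simp [hm]
  let j := hA.exact.desc _ hj
  have hgj : SA.g ≫ j = biprod.inl ≫ cokernel.π m := hA.exact.g_desc _ hj
  let r := cokernel.desc m _ hr
  have hπr : cokernel.π m ≫ r = biprod.snd ≫ SB.g := cokernel.π_desc _ _ _
  have hC : (ShortComplex.mk m (cokernel.π m) (cokernel.condition m)).Exact :=
    ShortComplex.exact_cokernel m
  refine ⟨hmono, j, r, ?_, { exact := ?_, mono_f := ?_, epi_g := ?_ }⟩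
  · rw [← cancel_epi SA.g, reassoc_of% hgj, hπr]
    simp
  · rw [ShortComplex.exact_iff_exact_up_to_refinements]
    intro B x hx
    dsimp at x hx ⊢
    obtain ⟨B₁, π₁, hπ₁, y, hy⟩ := surjective_up_to_refinements_of_epi (cokernel.π m) x
    have hy0 : (y ≫ biprod.snd) ≫ SB.g = 0 := by
      rw [Category.assoc, ← hπr, ← reassoc_of% hy, hx, comp_zero]
    obtain ⟨B₂, π₂, hπ₂, t, ht⟩ := surjective_up_to_refinements_of_epi S.g
      (hB.exact.lift _ hy0 ≫ eB.inv)
    have ht' : t ≫ S.g ≫ eB.hom ≫ SB.f = π₂ ≫ y ≫ biprod.snd := by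
      rw [← reassoc_of% ht, eB.inv_hom_id_assoc, hB.exact.lift_f]
    have hdec : π₂ ≫ y = (π₂ ≫ y ≫ biprod.fst - t ≫ e) ≫ biprod.inl + t ≫ m := by
      ext <;> simp [hm, ht']
    refine ⟨B₂, π₂ ≫ π₁, inferInstance, (π₂ ≫ y ≫ biprod.fst - t ≫ e) ≫ SA.g, ?_⟩
    rw [Category.assoc, hy, ← Category.assoc, hdec, Category.assoc, hgj]
    simp
  · refine Preadditive.mono_of_cancel_zero _ fun {B} x hx => ?_
    dsimp at x hx
    obtain ⟨B₁, π₁, hπ₁, y, hy⟩ := surjective_up_to_refinements_of_epi SA.g x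
    have hy0 : (y ≫ biprod.inl) ≫ cokernel.π m = 0 := by
      rw [Category.assoc, ← hgj, ← reassoc_of% hy, hx, comp_zero]
    let z := hC.lift _ hy0
    have hz : z ≫ m = y ≫ biprod.inl := hC.lift_f _ hy0
    obtain ⟨t, ht⟩ := hker z (by rw [reassoc_of% hz]; simp)
    have hty : t ≫ eA.hom ≫ SA.f = y := by
      rw [← he, reassoc_of% ht]
      simpa [hm] using congrArg (· ≫ biprod.fst) hz
    rw [← cancel_epi π₁, hy, ← hty]
    simp
  · have : Epi (cokernel.π m ≫ r) := by
      rw [hπr]; infer_instance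
    exact epi_of_epi (cokernel.π m) r

open Abelian

/-- Objects `M` such that `Ext (n + 1)` from `M` to any projective object vanishes. -/
def ExtOrthogonalProjective [HasExt.{w} A] (M : A) : Prop :=
  ∀ (Q : A), Projective Q → ∀ (n : ℕ) (x : Ext.{w} M Q (n + 1)), x = 0

/-- A class of objects, all orthogonal to projective objects, each member of which embeds in a
projective object with cokernel in the class. -/
def IsCoresolving [HasExt.{w} A] (𝒲 : A → Prop) : Prop :=
  ∀ N, 𝒲 N → ExtOrthogonalProjective.{w} N ∧
    ∃ (P N' : A) (i : N ⟶ P) (p : P ⟶ N') (h : i ≫ p = 0),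
      Projective P ∧ (ShortComplex.mk i p h).ShortExact ∧ 𝒲 N'

/-- Objects lying in a coresolving class: a description of Gorenstein projective objects in
terms of `Ext`. -/
def IsExtGorensteinProjective [HasExt.{w} A] (M : A) : Prop :=
  ∃ 𝒲 : A → Prop, 𝒲 M ∧ IsCoresolving.{w} 𝒲

section

variable [HasExt.{w} A]

lemma ExtOrthogonalProjective.of_retract {M N : A} (h : Retract M N)
    (hN : ExtOrthogonalProjective.{w} N) : ExtOrthogonalProjective.{w} M := by
  intro Q hQ n x
  have := hN Q hQ n ((Ext.mk₀ h.r).comp x (zero_add _))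
  have h2 := congrArg (fun y => (Ext.mk₀ h.i).comp y (zero_add _)) this
  simpa using h2

lemma ExtOrthogonalProjective.middle {S : ShortComplex A} (hS : S.ShortExact)
    (h₁ : ExtOrthogonalProjective.{w} S.X₁) (h₃ : ExtOrthogonalProjective.{w} S.X₃) :
    ExtOrthogonalProjective.{w} S.X₂ := by
  intro Q hQ n x
  obtain ⟨y, rfl⟩ := Ext.contravariant_sequence_exact₂ hS Q x (h₁ Q hQ n _)
  simp [h₃ Q hQ n y]

lemma ExtOrthogonalProjective.left {S : ShortComplex A} (hS : S.ShortExact)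
    (h₂ : Projective S.X₂) (h₃ : ExtOrthogonalProjective.{w} S.X₃) :
    ExtOrthogonalProjective.{w} S.X₁ := by
  intro Q hQ n x
  obtain ⟨y, rfl⟩ := Ext.contravariant_sequence_exact₁ hS Q x (add_comm 1 (n + 1))
    (h₃ Q hQ _ _)
  simp [Ext.eq_zero_of_projective y]

lemma ExtOrthogonalProjective.exists_extension {S : ShortComplex A} (hS : S.ShortExact)
    (h₃ : ExtOrthogonalProjective.{w} S.X₃) {Q : A} (hQ : Projective Q) (f : S.X₁ ⟶ Q) :
    ∃ g : S.X₂ ⟶ Q, S.f ≫ g = f := by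
  obtain ⟨y, hy⟩ := Ext.contravariant_sequence_exact₁ hS Q (Ext.mk₀ f) (add_zero 1)
    (h₃ Q hQ 0 _)
  obtain ⟨g, rfl⟩ := (Ext.mk₀_bijective _ _).2 y
  refine ⟨g, (Ext.mk₀_bijective _ _).1 ?_⟩
  simpa using hy

lemma isCoresolving_isExtGorensteinProjective :
    IsCoresolving.{w} (IsExtGorensteinProjective.{w} (A := A)) := by
  rintro N ⟨𝒲, hN, h𝒲⟩
  obtain ⟨h, P, N', i, p, hip, hP, hS, hN'⟩ := h𝒲 N hN
  exact ⟨h, P, N', i, p, hip, hP, hS, 𝒲, hN', h𝒲⟩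

lemma IsExtGorensteinProjective.extOrthogonalProjective {M : A}
    (hM : IsExtGorensteinProjective.{w} M) : ExtOrthogonalProjective.{w} M :=
  (isCoresolving_isExtGorensteinProjective M hM).1

lemma IsExtGorensteinProjective.left {S : ShortComplex A} (hS : S.ShortExact)
    (h₂ : Projective S.X₂) (h₃ : IsExtGorensteinProjective.{w} S.X₃) :
    IsExtGorensteinProjective.{w} S.X₁ := by
  refine ⟨fun N => N = S.X₁ ∨ IsExtGorensteinProjective.{w} N, Or.inl rfl, ?_⟩
  rintro N (rfl | hN)
  · exact ⟨.left hS h₂ h₃.extOrthogonalProjective, S.X₂, S.X₃, S.f, S.g, S.zero, h₂, hS,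
      Or.inr h₃⟩
  · obtain ⟨h, P, N', i, p, hip, hP, hS, hN'⟩ := isCoresolving_isExtGorensteinProjective N hN
    exact ⟨h, P, N', i, p, hip, hP, hS, Or.inr hN'⟩

lemma IsExtGorensteinProjective.middle {S : ShortComplex A} (hS : S.ShortExact)
    (h₁ : IsExtGorensteinProjective.{w} S.X₁) (h₃ : IsExtGorensteinProjective.{w} S.X₃) :
    IsExtGorensteinProjective.{w} S.X₂ := by
  refine ⟨fun N => ∃ S : ShortComplex A, S.ShortExact ∧ S.X₂ = N ∧
    IsExtGorensteinProjective.{w} S.X₁ ∧ IsExtGorensteinProjective.{w} S.X₃,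
    ⟨S, hS, rfl, h₁, h₃⟩, ?_⟩
  rintro _ ⟨S, hS, rfl, h₁, h₃⟩
  obtain ⟨o₁, P, A', a, a', wa, hP, hA, hA'⟩ := isCoresolving_isExtGorensteinProjective _ h₁
  obtain ⟨o₃, R, B', b, b', wb, hR, hB, hB'⟩ := isCoresolving_isExtGorensteinProjective _ h₃
  obtain ⟨e, he⟩ := o₃.exists_extension hS hP a
  obtain ⟨hm, j, r, h, hS'⟩ := exists_shortExact_cokernel_of_extension hS hA hB (Iso.refl _)
    (Iso.refl _) e (by simpa using he)
  exact ⟨.middle hS o₁ o₃, P ⊞ R, _, _, _, cokernel.condition _, inferInstance,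
    { exact := ShortComplex.exact_cokernel _ }, _, hS', rfl, hA', hB'⟩

/-- If `N` is a retract of `B` and `B` embeds in `P` with cokernel `L`, then the cokernel of
`N ⟶ P` is a direct summand of an extension of `L` by `B`. -/
lemma IsExtGorensteinProjective.cokernel_biprod {N B P L H : A} (ρ : Retract N B)
    {i : B ⟶ P} {q : P ⟶ L} {w₁ : i ≫ q = 0} (h₁ : (ShortComplex.mk i q w₁).ShortExact)
    {p : P ⟶ H} {w₂ : (ρ.i ≫ i) ≫ p = 0} (h₂ : (ShortComplex.mk (ρ.i ≫ i) p w₂).ShortExact)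
    (hB : IsExtGorensteinProjective.{w} B) (hL : IsExtGorensteinProjective.{w} L) :
    IsExtGorensteinProjective.{w} (H ⊞ N) := by
  have : Mono i := h₁.mono_f
  have : Epi q := h₁.epi_g
  have : Epi p := h₂.epi_g
  have hq : (ρ.i ≫ i) ≫ q = 0 := by rw [Category.assoc, w₁, comp_zero]
  obtain ⟨k, hk⟩ : ∃ k : H ⟶ L, p ≫ k = q := ⟨h₂.exact.desc q hq, h₂.exact.g_desc q hq⟩
  have hw : biprod.lift (i ≫ p) ρ.r ≫ biprod.desc k 0 = 0 := by simp [hk, w₁]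
  refine IsExtGorensteinProjective.middle (S := ShortComplex.mk _ _ hw)
    { exact := ?_, mono_f := ?_, epi_g := ?_ } hB hL
  · rw [ShortComplex.exact_iff_exact_up_to_refinements]
    intro T x hx
    dsimp at x hx ⊢
    obtain ⟨T', π, hπ, y, hy⟩ := surjective_up_to_refinements_of_epi p (x ≫ biprod.fst)
    have hx' : (x ≫ biprod.fst) ≫ k = 0 := by
      have h : biprod.fst ≫ k = biprod.desc k (0 : N ⟶ L) := by ext <;> simp
      rw [Category.assoc, h, hx]
    have hy0 : y ≫ q = 0 := by
      rw [← hk, ← reassoc_of% hy, ← Category.assoc x, hx', comp_zero]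
    obtain ⟨b, hb⟩ : ∃ b : T' ⟶ B, b ≫ i = y := ⟨h₁.exact.lift y hy0, h₁.exact.lift_f y hy0⟩
    have w₂' : ρ.i ≫ i ≫ p = 0 := by simpa using w₂
    refine ⟨T', π, hπ, b + (π ≫ x ≫ biprod.snd - b ≫ ρ.r) ≫ ρ.i, ?_⟩
    ext
    · simp [w₂', reassoc_of% hb, hy]
    · simp
  · refine Preadditive.mono_of_cancel_zero _ fun {T} x hx => ?_
    dsimp at x hx
    have hx₁ : (x ≫ i) ≫ p = 0 := by simpa using congrArg (· ≫ biprod.fst) hx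
    have hx₂ : x ≫ ρ.r = 0 := by simpa using congrArg (· ≫ biprod.snd) hx
    have hx₃ : h₂.exact.lift _ hx₁ ≫ ρ.i ≫ i = x ≫ i := h₂.exact.lift_f _ hx₁
    rw [← Category.assoc, cancel_mono] at hx₃
    have hx₄ : h₂.exact.lift _ hx₁ = 0 := by
      have h := congrArg (· ≫ ρ.r) hx₃
      simpa [hx₂] using h
    rw [← hx₃, hx₄, zero_comp]
  · have : Epi (p ≫ biprod.inl ≫ biprod.desc k (0 : N ⟶ L)) := by
      simpa [hk] using h₁.epi_g
    rw [← Category.assoc] at this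
    exact epi_of_epi (p ≫ biprod.inl) _

lemma IsExtGorensteinProjective.of_retract {M N : A} (h : Retract M N)
    (hN : IsExtGorensteinProjective.{w} N) : IsExtGorensteinProjective.{w} M := by
  refine ⟨fun M => ∃ N, Nonempty (Retract M N) ∧ IsExtGorensteinProjective.{w} N,
    ⟨N, ⟨h⟩, hN⟩, ?_⟩
  rintro M ⟨N, ⟨h⟩, hN⟩
  obtain ⟨o, P, L, i, q, hiq, hP, hS, hL⟩ := isCoresolving_isExtGorensteinProjective N hN
  have : Mono i := hS.mono_f
  have hC : (ShortComplex.mk (h.i ≫ i) (cokernel.π _) (cokernel.condition _)).ShortExact :=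
    { exact := ShortComplex.exact_cokernel _, mono_f := mono_comp _ _ }
  exact ⟨o.of_retract h, P, _, _, _, _, hP, hC, _,
    ⟨⟨biprod.inl, biprod.fst, by simp⟩⟩, .cokernel_biprod h hS hC hN hL⟩

lemma TotalSyzygies.extOrthogonalProjective (T : TotalSyzygies A) (n : ℤ) :
    ExtOrthogonalProjective.{w} (T.Z n) := by
  intro Q hQ k
  induction k generalizing n with
  | zero =>
    intro x
    obtain ⟨m, rfl⟩ : ∃ m, n = m + 1 := ⟨n - 1, by lia⟩
    have := T.projective m
    obtain ⟨y, rfl⟩ := Ext.contravariant_sequence_exact₃ (T.shortExact m) Q x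
      (Ext.eq_zero_of_projective (P := T.X m) _) (n₀ := 0) rfl
    obtain ⟨f, rfl⟩ := (Ext.mk₀_bijective _ _).2 y
    obtain ⟨g, rfl⟩ := T.extend Q hQ m f
    rw [← Ext.mk₀_comp_mk₀]
    exact (T.shortExact m).extClass_comp_assoc _
  | succ k ih =>
    intro x
    obtain ⟨m, rfl⟩ : ∃ m, n = m + 1 := ⟨n - 1, by lia⟩
    have := T.projective m
    obtain ⟨y, rfl⟩ := Ext.contravariant_sequence_exact₃ (T.shortExact m) Q x
      (Ext.eq_zero_of_projective (P := T.X m) _) (n₀ := k + 1) (by lia)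
    have hy : y = 0 := ih m y
    simp [hy]

lemma IsGorensteinProjective.isExtGorensteinProjective {M : A}
    (hM : IsGorensteinProjective M) : IsExtGorensteinProjective.{w} M := by
  obtain ⟨T, ⟨e⟩⟩ := hM.exists_totalSyzygies
  refine .of_retract e.retract ⟨fun N => ∃ n, T.Z n = N, ⟨0, rfl⟩, ?_⟩
  rintro _ ⟨n, rfl⟩
  exact ⟨T.extOrthogonalProjective n, _, _, _, _, _, T.projective n, T.shortExact n, _, rfl⟩

lemma IsExtGorensteinProjective.isGorensteinProjective [EnoughProjectives A] {M : A}
    (hM : IsExtGorensteinProjective.{w} M) : IsGorensteinProjective M := by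
  let 𝒢 := { N : A // IsExtGorensteinProjective.{w} N }
  let Step (N N' : 𝒢) : Prop := ∃ (P : A) (i : N.1 ⟶ P) (p : P ⟶ N'.1) (h : i ≫ p = 0),
    Projective P ∧ (ShortComplex.mk i p h).ShortExact
  have hright (N : 𝒢) : ∃ N' : 𝒢, Step N N' := by
    obtain ⟨-, P, N', i, p, h, hP, hS, hN'⟩ := isCoresolving_isExtGorensteinProjective N.1 N.2
    exact ⟨⟨N', hN'⟩, P, i, p, h, hP, hS⟩
  have hleft (N : 𝒢) : ∃ N' : 𝒢, Step N' N := by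
    have hS : (ShortComplex.mk (kernel.ι (Projective.π N.1)) (Projective.π N.1)
        (kernel.condition _)).ShortExact := { exact := ShortComplex.exact_kernel _ }
    exact ⟨⟨_, .left hS (Projective.projective_over N.1) N.2⟩, _, _, _, _,
      Projective.projective_over N.1, hS⟩
  choose R hR using hright
  choose L hL using hleft
  let Z : ℤ → 𝒢
    | .ofNat n => R^[n] ⟨M, hM⟩
    | .negSucc n => L^[n + 1] ⟨M, hM⟩
  have hZ (n : ℤ) : Step (Z n) (Z (n + 1)) := by
    rcases n with n | (_ | n)
    · change Step (R^[n] _) (R^[n + 1] _)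
      rw [Function.iterate_succ_apply']
      exact hR _
    · exact hL _
    · change Step (L^[n + 1 + 1] _) (L^[n + 1] _)
      rw [Function.iterate_succ_apply' L (n + 1)]
      exact hL _
  choose X ι π h hX hS using hZ
  exact TotalSyzygies.isGorensteinProjective ⟨fun n => (Z n).1, X, ι, π, h, hX, hS,
    fun Q hQ n f => (Z (n + 1)).2.extOrthogonalProjective.exists_extension (hS n) hQ f⟩
    (Iso.refl M)

end

end

/-- A functor which is both a left and a right adjoint of an additive functor preserves
Gorenstein projective objects. -/
lemma IsGorensteinProjective.map_of_adjunctions {C D : Type*} [Category C] [Category D]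
    [Abelian C] [Abelian D] {F : C ⥤ D} {G : D ⥤ C} [F.Additive]
    (adj₁ : F ⊣ G) (adj₂ : G ⊣ F) {M : C} (hM : IsGorensteinProjective M) :
    IsGorensteinProjective (F.obj M) := by
  obtain ⟨T, ⟨e⟩⟩ := hM.exists_totalSyzygies
  have := adj₁.leftAdjoint_preservesColimits
  have := adj₂.rightAdjoint_preservesLimits
  have := adj₁.rightAdjoint_preservesLimits
  have := adj₂.leftAdjoint_preservesColimits
  refine TotalSyzygies.isGorensteinProjective
    ⟨fun n => F.obj (T.Z n), fun n => F.obj (T.X n), fun n => F.map (T.ι n),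
      fun n => F.map (T.π n), fun n => by rw [← F.map_comp, T.w, F.map_zero],
      fun n => adj₁.map_projective _ (T.projective n),
      fun n => (T.shortExact n).map_of_exact F, ?_⟩ (F.mapIso e)
  intro Q hQ n f
  obtain ⟨g, hg⟩ := T.extend _ (adj₂.map_projective _ hQ) n (adj₁.homEquiv _ _ f)
  refine ⟨(adj₁.homEquiv _ _).symm g, (adj₁.homEquiv _ _).injective ?_⟩
  rw [adj₁.homEquiv_naturality_left, Equiv.apply_symm_apply, hg]

/-- Pushout step in the proof of Proposition 2.4: if `F(η_X)` is a split monomorphism,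
`0 → G(F(X)) → P⁰ → L¹ → 0` is exact with `P⁰` projective and `L¹` Gorenstein
projective, then in the pushout short exact sequence `0 → X → P⁰ → H¹ → 0`
(whose monomorphism is `η_X` followed by `G(F(X)) → P⁰`), the object `F(H¹)` is
Gorenstein projective. -/
theorem map_pushout_cokernel_gorensteinProjective {C D : Type*} [Category C] [Category D]
    [Abelian C] [Abelian D] [EnoughProjectives C] [EnoughProjectives D]
    (F : C ⥤ D) (G : D ⥤ C) [F.Additive] [G.Additive]
    (adj₁ : F ⊣ G) (adj₂ : G ⊣ F) (X : C)
    (hsplit : ∃ r : F.obj ((F ⋙ G).obj X) ⟶ F.obj X,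
      F.map (adj₁.unit.app X) ≫ r = 𝟙 (F.obj X))
    (P0 L1 H1 : C) (hP0 : Projective P0) (hL1 : IsGorensteinProjective L1)
    (i : (F ⋙ G).obj X ⟶ P0) (q : P0 ⟶ L1) (w1 : i ≫ q = 0)
    (h1 : (ShortComplex.mk i q w1).ShortExact)
    (p : P0 ⟶ H1) (w2 : (adj₁.unit.app X ≫ i) ≫ p = 0)
    (h2 : (ShortComplex.mk (adj₁.unit.app X ≫ i) p w2).ShortExact) :
    IsGorensteinProjective (F.obj H1) := by
  obtain ⟨r, hr⟩ := hsplit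
  have := HasExt.standard D
  have := adj₁.leftAdjoint_preservesColimits
  have := adj₂.rightAdjoint_preservesLimits
  have := adj₂.leftAdjoint_preservesColimits
  have h1' := h1.map_of_exact F
  have h2' := h2.map_of_exact F
  have hL := (hL1.map_of_adjunctions adj₁ adj₂).isExtGorensteinProjective
  have hP : Projective (F.obj P0) := adj₁.map_projective _ hP0
  have hB : IsExtGorensteinProjective (F.obj ((F ⋙ G).obj X)) := .left h1' hP hL
  let ρ : Retract (F.obj X) (F.obj ((F ⋙ G).obj X)) := ⟨F.map (adj₁.unit.app X), r, hr⟩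
  have w2' : (ρ.i ≫ F.map i) ≫ F.map p = 0 := by
    rw [← F.map_comp, ← F.map_comp, w2, F.map_zero]
  have h2'' : (ShortComplex.mk (ρ.i ≫ F.map i) (F.map p) w2').ShortExact := by
    convert h2' using 1
    simp [ShortComplex.map, ρ]
  have hH := IsExtGorensteinProjective.cokernel_biprod ρ h1' h2'' hB hL
  exact (hH.of_retract ⟨biprod.inl, biprod.fst, by simp⟩).isGorensteinProjective
end

section
/- In an abelian category A with enough projectives, if 0 → A → B → C → 0 is a short exact sequence with A and C Gorenstein projective, then B is Gorenstein projective (the class of Gorenstein projective objects is closed under extensions). -/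
open CategoryTheory Limits

namespace GorensteinProjective

variable {𝒜 : Type*} [Category 𝒜] [Abelian 𝒜]

/-- Every morphism from the source of `i` to a projective object extends along `i`. -/
def ExtendsToProjectives {X Y : 𝒜} (i : X ⟶ Y) : Prop :=
  ∀ Q : 𝒜, Projective Q → ∀ k : X ⟶ Q, ∃ l : Y ⟶ Q, i ≫ l = k

/-- `X` is the kernel and `Y` the cokernel in a short exact sequence `0 → X → P → Y → 0` with `P`
projective which stays exact under `Hom(-, Q)` for every projective `Q`. -/
def IsSyzygyStep (X Y : 𝒜) : Prop :=
  ∃ (P : 𝒜) (i : X ⟶ P) (p : P ⟶ Y) (w : i ≫ p = 0),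
    Projective P ∧ (ShortComplex.mk i p w).ShortExact ∧ ExtendsToProjectives i

/-- There is a short exact sequence `0 → A → B → C → 0`. -/
def IsExtension (A B C : 𝒜) : Prop :=
  ∃ (f : A ⟶ B) (g : B ⟶ C) (w : f ≫ g = 0), (ShortComplex.mk f g w).ShortExact

lemma IsSyzygyStep.exists_of_exactAt (P : CochainComplex 𝒜 ℤ) (hP : ∀ n, Projective (P.X n))
    (hex : ∀ n, P.ExactAt n)
    (hQ : ∀ (Q : 𝒜), Projective Q → ∀ (n : ℤ) (f : P.X n ⟶ Q), P.d (n - 1) n ≫ f = 0 →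
      ∃ g : P.X (n + 1) ⟶ Q, P.d n (n + 1) ≫ g = f) (n : ℤ) :
    IsSyzygyStep (P.cycles n) (P.cycles (n + 1)) := by
  have hepi : ∀ m : ℤ, Epi (P.toCycles m (m + 1)) := fun m => by
    have h := hex (m + 1)
    rw [P.exactAt_iff_exact_up_to_refinements m (m + 1) (m + 1 + 1) (by simp) (by simp)] at h
    rw [epi_iff_surjective_up_to_refinements]
    intro T y
    obtain ⟨T', π, hπ, x, hx⟩ := h (y ≫ P.iCycles (m + 1)) (by simp)
    refine ⟨T', π, hπ, x, ?_⟩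
    rw [← cancel_mono (P.iCycles (m + 1))]
    simpa only [Category.assoc, P.toCycles_i] using hx
  have hw : P.iCycles n ≫ P.toCycles n (n + 1) = 0 := by
    rw [← cancel_mono (P.iCycles (n + 1))]; simp
  refine ⟨P.X n, P.iCycles n, P.toCycles n (n + 1), hw, hP n, ?_, ?_⟩
  · have := hepi n
    refine ⟨?_⟩
    rw [ShortComplex.exact_iff_exact_up_to_refinements]
    intro T x hx
    dsimp at x hx
    have hx' : x ≫ P.d n (n + 1) = 0 := by
      rw [← P.toCycles_i n (n + 1), reassoc_of% hx, zero_comp]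
    exact ⟨T, 𝟙 T, inferInstance, P.liftCycles x (n + 1) (by simp) hx', by simp⟩
  · intro Q hQproj k
    obtain ⟨m, rfl⟩ : ∃ m : ℤ, n = m + 1 := ⟨n - 1, by ring⟩
    have := hepi m
    obtain ⟨g, hg⟩ := hQ Q hQproj m (P.toCycles m (m + 1) ≫ k) (by simp)
    refine ⟨g, ?_⟩
    rw [← cancel_epi (P.toCycles m (m + 1)), ← hg, ← Category.assoc, P.toCycles_i]

lemma exists_seq (S : 𝒜 → Prop) (hnext : ∀ X, S X → ∃ Y, S Y ∧ IsSyzygyStep X Y)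
    (hprev : ∀ Y, S Y → ∃ X, S X ∧ IsSyzygyStep X Y) {M : 𝒜} (hM : S M) :
    ∃ X : ℤ → 𝒜, X 0 = M ∧ ∀ n, IsSyzygyStep (X n) (X (n + 1)) := by
  choose next hSnext hnext using hnext
  choose prev hSprev hprev using hprev
  let F : ℕ → {X // S X} := fun n =>
    Nat.rec ⟨M, hM⟩ (fun _ X => ⟨next X.1 X.2, hSnext X.1 X.2⟩) n
  let G : ℕ → {X // S X} := fun n =>
    Nat.rec ⟨M, hM⟩ (fun _ X => ⟨prev X.1 X.2, hSprev X.1 X.2⟩) n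
  let X : ℤ → 𝒜 := fun n =>
    match n with
    | Int.ofNat n => (F n).1
    | Int.negSucc n => (G (n + 1)).1
  refine ⟨X, rfl, fun n => ?_⟩
  match n with
  | Int.ofNat n => exact hnext (F n).1 (F n).2
  | Int.negSucc 0 => exact hprev M hM
  | Int.negSucc (n + 1) => exact hprev (G (n + 1)).1 (G (n + 1)).2

lemma isGorensteinProjective_of_seq (X : ℤ → 𝒜) (hX : ∀ n, IsSyzygyStep (X n) (X (n + 1))) :
    IsGorensteinProjective (X 0) := by
  choose P i p w hP hS hext using hX
  have hmono : ∀ n, Mono (i n) := fun n => (hS n).mono_f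
  have hepi : ∀ n, Epi (p n) := fun n => (hS n).epi_g
  let K : CochainComplex 𝒜 ℤ := CochainComplex.of P (fun n => p n ≫ i (n + 1))
    (fun n => by simp [reassoc_of% (w (n + 1))])
  have hd : ∀ n, K.d n (n + 1) = p n ≫ i (n + 1) := fun n =>
    CochainComplex.of_d P (fun n => p n ≫ i (n + 1)) n
  refine ⟨K, hP, fun n => ?_, ?_, ?_⟩
  · obtain ⟨m, rfl⟩ : ∃ m : ℤ, n = m + 1 := ⟨n - 1, by ring⟩
    rw [K.exactAt_iff_exact_up_to_refinements m (m + 1) (m + 1 + 1) (by simp) (by simp)]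
    intro T x hx
    rw [hd, ← Category.assoc] at hx
    have hx' : x ≫ p (m + 1) = 0 := by
      rw [← cancel_mono (i (m + 1 + 1)), hx, zero_comp]
    obtain ⟨y, hy⟩ := (hS (m + 1)).exact.lift' x hx'
    obtain ⟨T', π, hπ, z, hz⟩ := surjective_up_to_refinements_of_epi (p m) y
    refine ⟨T', π, hπ, z, ?_⟩
    rw [hd]
    dsimp at hy
    rw [← hy, reassoc_of% hz]
  · have hw : i 0 ≫ K.d 0 (0 + 1) = 0 := by rw [hd, reassoc_of% (w 0), zero_comp]
    have hi : IsLimit (KernelFork.ofι (i 0) hw) :=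
      isKernelCompMono (hS 0).fIsKernel (i (0 + 1)) (hd 0)
    exact ⟨hi.conePointUniqueUpToIso (K.cyclesIsKernel 0 (0 + 1) (by simp))⟩
  · intro Q hQ n f hf
    obtain ⟨m, rfl⟩ : ∃ m : ℤ, n = m + 1 := ⟨n - 1, by ring⟩
    rw [show m + 1 - 1 = m by ring, hd, Category.assoc] at hf
    have hf' : i (m + 1) ≫ f = 0 := by rw [← cancel_epi (p m), hf, comp_zero]
    obtain ⟨k, hk⟩ := (hS (m + 1)).exact.desc' f hf'
    obtain ⟨l, hl⟩ := hext (m + 1 + 1) Q hQ k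
    exact ⟨l, by rw [hd, Category.assoc, hl]; exact hk⟩

/-- In a commutative diagram whose first row is right exact and whose second row is
the split sequence `P ⟶ P ⊞ P' ⟶ P'`, extension to projectives along the outer vertical morphisms
implies it for the middle one. -/
lemma ExtendsToProjectives.biprod {A B C P P' : 𝒜} {f : A ⟶ B} {g : B ⟶ C} {w : f ≫ g = 0}
    (h : (ShortComplex.mk f g w).ShortExact) {i : A ⟶ P} {k : C ⟶ P'} {j : B ⟶ P ⊞ P'}
    (hf : f ≫ j = i ≫ biprod.inl) (hg : j ≫ biprod.snd = g ≫ k)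
    (hi : ExtendsToProjectives i) (hk : ExtendsToProjectives k) : ExtendsToProjectives j := by
  intro Q hQ b
  have := h.epi_g
  obtain ⟨l, hl⟩ := hi Q hQ (f ≫ b)
  obtain ⟨c, hc⟩ := h.exact.desc' (b - j ≫ biprod.fst ≫ l)
    (by simp [reassoc_of% hf, hl])
  obtain ⟨l', hl'⟩ := hk Q hQ c
  refine ⟨biprod.fst ≫ l + biprod.snd ≫ l', ?_⟩
  dsimp at hc
  rw [Preadditive.comp_add, reassoc_of% hg, hl', hc]
  abel

/-- Horseshoe lemma: syzygies of an extension can be chosen to form an extension. -/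
lemma IsExtension.exists_prev {A B C A' C' : 𝒜} (h : IsExtension A B C)
    (hA : IsSyzygyStep A' A) (hC : IsSyzygyStep C' C) :
    ∃ B', IsExtension A' B' C' ∧ IsSyzygyStep B' B := by
  obtain ⟨f, g, w, h⟩ := h
  obtain ⟨P, i, p, wA, hP, hSA, hiA⟩ := hA
  obtain ⟨P', k, q, wC, hP', hSC, hkC⟩ := hC
  have := h.mono_f
  have := h.epi_g
  have := hSA.mono_f
  have := hSA.epi_g
  have := hSC.mono_f
  have := hSC.epi_g
  dsimp at *
  let u : P' ⟶ B := Projective.factorThru q g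
  have hu : u ≫ g = q := Projective.factorThru_comp q g
  let r : P ⊞ P' ⟶ B := biprod.desc (p ≫ f) u
  have hr : r ≫ g = biprod.snd ≫ q := by ext <;> simp [r, w, hu]
  have hepi : Epi r := by
    rw [epi_iff_surjective_up_to_refinements]
    intro T b
    obtain ⟨T₁, π₁, _, c, hc⟩ := surjective_up_to_refinements_of_epi q (b ≫ g)
    obtain ⟨a, ha⟩ := h.exact.lift' (π₁ ≫ b - c ≫ u) (by simp [hu, hc])
    obtain ⟨T₂, π₂, _, t, ht⟩ := surjective_up_to_refinements_of_epi p a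
    refine ⟨T₂, π₂ ≫ π₁, epi_comp _ _, biprod.lift t (π₂ ≫ c), ?_⟩
    dsimp at ha
    simp [r, ← reassoc_of% ht, ha]
  have hα : (i ≫ biprod.inl) ≫ r = 0 := by simp [r, reassoc_of% wA]
  let α : A' ⟶ kernel r := kernel.lift r (i ≫ biprod.inl) hα
  have hαι : α ≫ kernel.ι r = i ≫ biprod.inl := kernel.lift_ι _ _ _
  obtain ⟨β, hβ⟩ : ∃ β : kernel r ⟶ C', β ≫ k = kernel.ι r ≫ biprod.snd := by
    obtain ⟨β, hβ⟩ := hSC.exact.lift' (kernel.ι r ≫ biprod.snd)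
      (by simp [← hr])
    exact ⟨β, hβ⟩
  have hαβ : α ≫ β = 0 := by rw [← cancel_mono k]; simp [hβ, reassoc_of% hαι]
  have hαmono : Mono α := by
    have : Mono (α ≫ kernel.ι r) := by rw [hαι]; infer_instance
    exact mono_of_mono α (kernel.ι r)
  have hβepi : Epi β := by
    rw [epi_iff_surjective_up_to_refinements]
    intro T c
    obtain ⟨a, ha⟩ := h.exact.lift' (c ≫ k ≫ u) (by simp [hu, wC])
    obtain ⟨T₁, π, hπ, t, ht⟩ := surjective_up_to_refinements_of_epi p a
    dsimp at ha
    refine ⟨T₁, π, hπ, kernel.lift r (biprod.lift (-t) (π ≫ c ≫ k)) ?_, ?_⟩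
    · simp [r, ← reassoc_of% ht, ha]
    · rw [← cancel_mono k]
      simp [hβ]
  have hext : (ShortComplex.mk α β hαβ).ShortExact := by
    refine ⟨?_⟩
    rw [ShortComplex.exact_iff_exact_up_to_refinements]
    intro T b hb
    dsimp at b hb
    have hsnd : b ≫ kernel.ι r ≫ biprod.snd = 0 := by rw [← hβ, reassoc_of% hb, zero_comp]
    have hb' : b ≫ kernel.ι r = (b ≫ kernel.ι r ≫ biprod.fst) ≫ biprod.inl := by
      ext <;> simp [hsnd]
    obtain ⟨a, ha⟩ := hSA.exact.lift' (b ≫ kernel.ι r ≫ biprod.fst) (by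
      dsimp
      rw [← cancel_mono f, zero_comp]
      have : (b ≫ kernel.ι r) ≫ r = 0 := by simp
      rw [hb'] at this
      simpa [r] using this)
    dsimp at ha
    refine ⟨T, 𝟙 T, inferInstance, a, ?_⟩
    rw [← cancel_mono (kernel.ι r)]
    simp only [Category.id_comp, Category.assoc]
    rw [hαι, hb', ← ha, Category.assoc]
  refine ⟨kernel r, ⟨α, β, hαβ, hext⟩, P ⊞ P', kernel.ι r, r, kernel.condition r, inferInstance,
    ⟨ShortComplex.exact_of_f_is_kernel _ (kernelIsKernel r)⟩,
    ExtendsToProjectives.biprod hext hαι hβ.symm hiA hkC⟩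

/-- Morphisms from `A` to a projective object `P` extend along `f` in a short exact sequence
`0 ⟶ A ⟶ B ⟶ C ⟶ 0` whenever `C` is the cokernel in a syzygy step. -/
lemma ExtendsToProjectives.of_isSyzygyStep {A B C C₀ : 𝒜} {f : A ⟶ B} {g : B ⟶ C} {w : f ≫ g = 0}
    (h : (ShortComplex.mk f g w).ShortExact) (hC : IsSyzygyStep C₀ C) :
    ExtendsToProjectives f := by
  intro P hP i
  obtain ⟨P', k, q, wC, hP', hSC, hkC⟩ := hC
  have := h.mono_f
  have := h.epi_g
  have := hSC.mono_f
  have := hSC.epi_g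
  dsimp at *
  let u : P' ⟶ B := Projective.factorThru q g
  have hu : u ≫ g = q := Projective.factorThru_comp q g
  obtain ⟨θ, hθ⟩ := h.exact.lift' (k ≫ u) (by simp [hu, wC])
  obtain ⟨l, hl⟩ := hkC P hP (θ ≫ i)
  dsimp at hθ
  let φ : A ⊞ P' ⟶ B := biprod.desc f u
  let ψ : A ⊞ P' ⟶ P := biprod.desc i l
  have hφ : Epi φ := by
    rw [epi_iff_surjective_up_to_refinements]
    intro T b
    obtain ⟨T₁, π, hπ, c, hc⟩ := surjective_up_to_refinements_of_epi q (b ≫ g)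
    obtain ⟨a, ha⟩ := h.exact.lift' (π ≫ b - c ≫ u) (by simp [hu, hc])
    dsimp at ha
    exact ⟨T₁, π, hπ, biprod.lift a c, by simp [φ, ha]⟩
  have hφψ : kernel.ι φ ≫ ψ = 0 := by
    have hx : kernel.ι φ ≫ biprod.fst ≫ f + kernel.ι φ ≫ biprod.snd ≫ u = 0 := by
      rw [← Preadditive.comp_add, ← biprod.desc_eq]
      exact kernel.condition φ
    obtain ⟨y, hy⟩ := hSC.exact.lift' (kernel.ι φ ≫ biprod.snd) (by
      have := hx =≫ g
      simpa [hu, w] using this)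
    dsimp at hy
    have hfst : kernel.ι φ ≫ biprod.fst = - (y ≫ θ) := by
      rw [← cancel_mono f]
      simp only [Category.assoc, Preadditive.neg_comp, hθ, reassoc_of% hy]
      exact eq_neg_of_add_eq_zero_left hx
    rw [show ψ = biprod.fst ≫ i + biprod.snd ≫ l from biprod.desc_eq, Preadditive.comp_add,
      reassoc_of% hfst, ← reassoc_of% hy, hl]
    simp
  refine ⟨Abelian.epiDesc φ ψ hφψ, ?_⟩
  have hf : f = biprod.inl ≫ φ := by simp [φ]
  rw [hf, Category.assoc, Abelian.comp_epiDesc]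
  simp [ψ]

/-- Dual horseshoe lemma: cosyzygies of an extension can be chosen to form an extension, provided
that the quotient of the extension is itself the cokernel in a syzygy step. -/
lemma IsExtension.exists_next {A B C A' C' C₀ : 𝒜} (h : IsExtension A B C)
    (hA : IsSyzygyStep A A') (hC : IsSyzygyStep C C') (hC₀ : IsSyzygyStep C₀ C) :
    ∃ B', IsExtension A' B' C' ∧ IsSyzygyStep B B' := by
  obtain ⟨f, g, w, h⟩ := h
  obtain ⟨P, i, p, wA, hP, hSA, hiA⟩ := hA
  obtain ⟨P', k, q, wC, hP', hSC, hkC⟩ := hC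
  obtain ⟨m, hm⟩ := ExtendsToProjectives.of_isSyzygyStep h hC₀ P hP i
  have := h.mono_f
  have := h.epi_g
  have := hSA.mono_f
  have := hSA.epi_g
  have := hSC.mono_f
  have := hSC.epi_g
  dsimp at *
  let j : B ⟶ P ⊞ P' := biprod.lift m (g ≫ k)
  have hfj : f ≫ j = i ≫ biprod.inl := by ext <;> simp [j, hm, reassoc_of% w]
  have hj : j ≫ biprod.snd = g ≫ k := by simp [j]
  have hjmono : Mono j := by
    refine Preadditive.mono_of_cancel_zero _ fun {T} b hb => ?_
    have hbg : b ≫ g = 0 := by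
      rw [← cancel_mono k, Category.assoc, ← hj, reassoc_of% hb, zero_comp, zero_comp]
    obtain ⟨a, ha⟩ := h.exact.lift' b hbg
    dsimp at ha
    have : a = 0 := by
      rw [← cancel_mono (i ≫ (biprod.inl : P ⟶ P ⊞ P')), ← hfj, reassoc_of% ha, hb, zero_comp]
    rw [← ha, this, zero_comp]
  have hSB : (ShortComplex.mk j (cokernel.π j) (cokernel.condition j)).ShortExact :=
    ⟨ShortComplex.exact_of_g_is_cokernel _ (cokernelIsCokernel j)⟩
  obtain ⟨α, hα⟩ : ∃ α : A' ⟶ cokernel j, p ≫ α = biprod.inl ≫ cokernel.π j := by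
    obtain ⟨α, hα⟩ := hSA.exact.desc' (biprod.inl ≫ cokernel.π j)
      (by simp [← reassoc_of% hfj])
    exact ⟨α, hα⟩
  let β : cokernel j ⟶ C' := cokernel.desc j (biprod.snd ≫ q) (by simp [reassoc_of% hj, wC])
  have hβ : cokernel.π j ≫ β = biprod.snd ≫ q := cokernel.π_desc _ _ _
  have hαβ : α ≫ β = 0 := by rw [← cancel_epi p]; simp [hβ, reassoc_of% hα]
  have hβepi : Epi β := by
    have : Epi (cokernel.π j ≫ β) := by rw [hβ]; infer_instance
    exact epi_of_epi (cokernel.π j) β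
  have hαmono : Mono α := by
    refine Preadditive.mono_of_cancel_zero _ fun {T} x hx => ?_
    obtain ⟨T₁, π, _, t, ht⟩ := surjective_up_to_refinements_of_epi p x
    obtain ⟨b, hb⟩ := hSB.exact.lift' (t ≫ biprod.inl)
      (by simp [← hα, ← reassoc_of% ht, hx])
    dsimp at hb
    have hbg : b ≫ g = 0 := by
      rw [← cancel_mono k, Category.assoc, ← hj, reassoc_of% hb]
      simp
    obtain ⟨a, ha⟩ := h.exact.lift' b hbg
    dsimp at ha
    have hat : a ≫ i = t := by
      rw [← cancel_mono (biprod.inl : P ⟶ P ⊞ P'), Category.assoc, ← hfj, reassoc_of% ha, hb]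
    rw [← cancel_epi π, ht, ← hat, Category.assoc, wA, comp_zero, comp_zero]
  have hext : (ShortComplex.mk α β hαβ).ShortExact := by
    refine ⟨?_⟩
    rw [ShortComplex.exact_iff_exact_up_to_refinements]
    intro T x hx
    dsimp at x hx
    obtain ⟨T₁, π₁, _, e, he⟩ := surjective_up_to_refinements_of_epi (cokernel.π j) x
    obtain ⟨c, hc⟩ := hSC.exact.lift' (e ≫ biprod.snd)
      (by simp [← hβ, ← reassoc_of% he, hx])
    obtain ⟨T₂, π₂, _, b, hb⟩ := surjective_up_to_refinements_of_epi g c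
    dsimp at hc
    have hs : (π₂ ≫ e - b ≫ j) ≫ biprod.snd = 0 := by
      simp [hj, ← reassoc_of% hb, hc]
    refine ⟨T₂, π₂ ≫ π₁, epi_comp _ _, (π₂ ≫ e - b ≫ j) ≫ biprod.fst ≫ p, ?_⟩
    have ht : ((π₂ ≫ e - b ≫ j) ≫ biprod.fst) ≫ biprod.inl = π₂ ≫ e - b ≫ j := by
      apply biprod.hom_ext
      · simp
      · rw [hs]; simp
    simp only [Category.assoc] at ht ⊢
    rw [hα, reassoc_of% ht, he]
    simp
  exact ⟨cokernel j, ⟨α, β, hαβ, hext⟩, P ⊞ P', j, cokernel.π j, cokernel.condition j,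
    inferInstance, hSB, ExtendsToProjectives.biprod h hfj hj hiA hkC⟩

end GorensteinProjective

/-- In an abelian category with enough projectives, the class of Gorenstein projective
objects is closed under extensions. -/
theorem isGorensteinProjective_of_shortExact {𝒜 : Type*} [Category 𝒜] [Abelian 𝒜]
    [EnoughProjectives 𝒜] {A B C : 𝒜} (f : A ⟶ B) (g : B ⟶ C) (w : f ≫ g = 0)
    (h : (ShortComplex.mk f g w).ShortExact)
    (hA : IsGorensteinProjective A) (hC : IsGorensteinProjective C) :
    IsGorensteinProjective B := by
  obtain ⟨P, hP, hPex, ⟨eA⟩, hPQ⟩ := hA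
  obtain ⟨P', hP', hPex', ⟨eC⟩, hPQ'⟩ := hC
  have hstepA := GorensteinProjective.IsSyzygyStep.exists_of_exactAt P hP hPex hPQ
  have hstepC := GorensteinProjective.IsSyzygyStep.exists_of_exactAt P' hP' hPex' hPQ'
  obtain ⟨X, rfl, hX⟩ := GorensteinProjective.exists_seq (M := B)
    (fun B => ∃ n : ℤ, GorensteinProjective.IsExtension (P.cycles n) B (P'.cycles n))
    (fun X ⟨n, hX⟩ => by
      obtain ⟨m, rfl⟩ : ∃ m : ℤ, n = m + 1 := ⟨n - 1, by ring⟩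
      obtain ⟨Y, hY, hXY⟩ := hX.exists_next (hstepA _) (hstepC _) (hstepC m)
      exact ⟨Y, ⟨_, hY⟩, hXY⟩)
    (fun Y ⟨n, hY⟩ => by
      obtain ⟨m, rfl⟩ : ∃ m : ℤ, n = m + 1 := ⟨n - 1, by ring⟩
      obtain ⟨X, hX, hXY⟩ := hY.exists_prev (hstepA m) (hstepC m)
      exact ⟨X, ⟨_, hX⟩, hXY⟩)
    ⟨0, eA.inv ≫ f, g ≫ eC.hom, by simp [reassoc_of% w],
      ShortComplex.shortExact_of_iso (ShortComplex.isoMk eA (Iso.refl B) eC) h⟩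
  exact GorensteinProjective.isGorensteinProjective_of_seq X hX
end

section
/- In an abelian category A with enough projectives, a direct summand of a Gorenstein projective object is Gorenstein projective. -/
open CategoryTheory Limits

namespace GorensteinProjective

open Abelian

/-- A relation which can be iterated forwards from `p` and backwards from `q` admits a
bi-infinite chain through any element satisfying `p`. -/
lemma exists_int_chain {α : Type*} (R : α → α → Prop) (p q : α → Prop)
    (hp : ∀ x, p x → ∃ y, R x y ∧ p y) (hq : ∀ x, q x → ∃ y, R y x ∧ q y)
    (hpq : ∀ x, p x → q x) (x₀ : α) (h₀ : p x₀) :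
    ∃ Z : ℤ → α, Z 0 = x₀ ∧ (∀ n, R (Z n) (Z (n + 1))) ∧ ∀ n, q (Z n) := by
  choose f hf using hp
  choose g hg using hq
  let F : ℕ → Subtype p := fun n ↦ Nat.rec ⟨x₀, h₀⟩ (fun _ x ↦ ⟨f x.1 x.2, (hf x.1 x.2).2⟩) n
  let G : ℕ → Subtype q := fun n ↦
    Nat.rec ⟨x₀, hpq _ h₀⟩ (fun _ x ↦ ⟨g x.1 x.2, (hg x.1 x.2).2⟩) n
  have hF (n : ℕ) : R (F n).1 (F (n + 1)).1 := (hf (F n).1 (F n).2).1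
  have hG (n : ℕ) : R (G (n + 1)).1 (G n).1 := (hg (G n).1 (G n).2).1
  let Z : ℤ → α := fun n ↦ match n with
    | Int.ofNat n => (F n).1
    | Int.negSucc n => (G (n + 1)).1
  refine ⟨Z, rfl, fun n ↦ ?_, fun n ↦ ?_⟩
  · match n with
    | Int.ofNat n => exact hF n
    | Int.negSucc 0 => exact hG 0
    | Int.negSucc (n + 1) => exact hG (n + 1)
  · match n with
    | Int.ofNat n => exact hpq _ (F n).2
    | Int.negSucc n => exact (G (n + 1)).2

variable {A : Type*} [Category A] [Abelian A]

/-- `Y` is the cokernel of an embedding of `X` into a projective object. -/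
def ProjStep (X Y : A) : Prop :=
  ∃ (P : A) (_ : Projective P) (ι : X ⟶ P) (π : P ⟶ Y) (w : ι ≫ π = 0),
    (ShortComplex.mk ι π w).ShortExact

section Ext

universe w

variable [HasExt.{w} A]

/-- All positive `Ext` groups from `X` to projective objects vanish. -/
def ExtVanish (X : A) : Prop :=
  ∀ (Q : A), Projective Q → ∀ (n : ℕ) (e : Ext.{w} X Q (n + 1)), e = 0

lemma ExtVanish.of_retract {X Y : A} (h : ExtVanish.{w} Y) (i : X ⟶ Y) (r : Y ⟶ X)
    (hir : i ≫ r = 𝟙 X) : ExtVanish.{w} X := by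
  intro Q hQ n e
  rw [← Ext.mk₀_id_comp e, ← hir, ← Ext.mk₀_comp_mk₀_assoc,
    h Q hQ n ((Ext.mk₀ r).comp e (zero_add _)), Ext.comp_zero]

lemma ExtVanish.middle {S : ShortComplex A} (hS : S.ShortExact) (h₁ : ExtVanish.{w} S.X₁)
    (h₃ : ExtVanish.{w} S.X₃) : ExtVanish.{w} S.X₂ := by
  intro Q hQ n e
  obtain ⟨e', rfl⟩ := Ext.contravariant_sequence_exact₂ hS Q e (h₁ Q hQ n _)
  rw [h₃ Q hQ n e', Ext.comp_zero]

lemma ExtVanish.of_projStep {X Y : A} (h : ProjStep X Y) (hY : ExtVanish.{w} Y) :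
    ExtVanish.{w} X := by
  obtain ⟨P, hP, ι, π, w, hS⟩ := h
  intro Q hQ n e
  obtain ⟨e', rfl⟩ := Ext.contravariant_sequence_exact₁ hS Q e (add_comm _ _) (hY Q hQ _ _)
  have he' : e' = 0 := Ext.eq_zero_of_projective (P := P) e'
  rw [he', Ext.comp_zero]

lemma exists_projStep_left [EnoughProjectives A] (X : A) (hX : ExtVanish.{w} X) :
    ∃ Y : A, ProjStep Y X ∧ ExtVanish.{w} Y := by
  have h : ProjStep (kernel (Projective.π X)) X :=
    ⟨_, inferInstance, kernel.ι _, Projective.π X, kernel.condition _,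
      { exact := ShortComplex.exact_kernel _ }⟩
  exact ⟨_, h, hX.of_projStep h⟩

/-- If `Ext¹(S.X₃, Q)` vanishes, then morphisms `S.X₁ ⟶ Q` extend to `S.X₂`. -/
lemma ExtVanish.exists_extension {S : ShortComplex A} (hS : S.ShortExact)
    (h : ExtVanish.{w} S.X₃) {Q : A} (hQ : Projective Q) (f : S.X₁ ⟶ Q) :
    ∃ g : S.X₂ ⟶ Q, S.f ≫ g = f := by
  obtain ⟨e, he⟩ := Ext.contravariant_sequence_exact₁ hS Q (Ext.mk₀ f) (add_zero 1)
    (h Q hQ 0 _)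
  obtain ⟨g, rfl⟩ := (Ext.mk₀_bijective _ _).2 e
  rw [Ext.mk₀_comp_mk₀] at he
  exact ⟨g, (Ext.mk₀_bijective _ _).1 he⟩

/-- `X` belongs to a class of objects with vanishing positive `Ext` into projectives which is
closed under choosing suitable cokernels of embeddings into projectives. -/
def HasCoresolution (X : A) : Prop :=
  ∃ S : A → Prop, S X ∧ ∀ Y, S Y → ExtVanish.{w} Y ∧ ∃ Z, ProjStep Y Z ∧ S Z

lemma HasCoresolution.extVanish {X : A} (h : HasCoresolution.{w} X) : ExtVanish.{w} X := by
  obtain ⟨S, hX, hS⟩ := h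
  exact (hS X hX).1

lemma HasCoresolution.exists_projStep {X : A} (h : HasCoresolution.{w} X) :
    ∃ Y, ProjStep X Y ∧ HasCoresolution.{w} Y := by
  obtain ⟨S, hX, hS⟩ := h
  obtain ⟨Y, hXY, hY⟩ := (hS X hX).2
  exact ⟨Y, hXY, S, hY, hS⟩

end Ext

/-- The horseshoe construction for embeddings of the outer terms of a short exact sequence,
given an extension `h` of the first embedding to the middle term. -/
lemma horseshoe {S : ShortComplex A} (hS : S.ShortExact) {P X Q Y : A}
    (a : S.X₁ ⟶ P) (p : P ⟶ X) (w : a ≫ p = 0) (ha : (ShortComplex.mk a p w).ShortExact)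
    (b : S.X₃ ⟶ Q) (q : Q ⟶ Y) (w' : b ≫ q = 0) (hb : (ShortComplex.mk b q w').ShortExact)
    (h : S.X₂ ⟶ P) (hh : S.f ≫ h = a) :
    Mono (biprod.lift h (S.g ≫ b)) ∧
    ∃ (f : X ⟶ cokernel (biprod.lift h (S.g ≫ b)))
      (g : cokernel (biprod.lift h (S.g ≫ b)) ⟶ Y) (w : f ≫ g = 0),
      (ShortComplex.mk f g w).ShortExact := by
  have := hS.mono_f
  have := hS.epi_g
  have : Mono a := ha.mono_f
  have : Epi p := ha.epi_g
  have : Mono b := hb.mono_f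
  have : Epi q := hb.epi_g
  have hj : Mono (biprod.lift h (S.g ≫ b)) := by
    refine Preadditive.mono_of_cancel_zero _ fun {T} x hx ↦ ?_
    have h1 : x ≫ h = 0 := by simpa using hx =≫ biprod.fst
    have h2 : x ≫ S.g = 0 := by
      rw [← cancel_mono b]
      simpa using hx =≫ biprod.snd
    have h3 : hS.exact.lift x h2 ≫ S.f = x := hS.exact.lift_f _ _
    have h4 : hS.exact.lift x h2 = 0 := by
      rw [← cancel_mono a, ← hh, reassoc_of% h3, h1, zero_comp]
    rw [← h3, h4, zero_comp]
  let j := biprod.lift h (S.g ≫ b)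
  have hf : a ≫ biprod.inl ≫ cokernel.π j = 0 := by
    have : a ≫ biprod.inl = S.f ≫ j := by ext <;> simp [j, hh]
    rw [reassoc_of% this, cokernel.condition, comp_zero]
  have hg : j ≫ biprod.snd ≫ q = 0 := by simp [j, w']
  let f : X ⟶ cokernel j := ha.exact.desc (biprod.inl ≫ cokernel.π j) hf
  let g : cokernel j ⟶ Y := cokernel.desc j (biprod.snd ≫ q) hg
  have hpf : p ≫ f = biprod.inl ≫ cokernel.π j := ha.exact.g_desc _ _
  have hπg : cokernel.π j ≫ g = biprod.snd ≫ q := cokernel.π_desc _ _ _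
  have hfg : f ≫ g = 0 := by
    rw [← cancel_epi p, reassoc_of% hpf, hπg]
    simp
  have hjex := ShortComplex.exact_cokernel j
  refine ⟨hj, f, g, hfg, { exact := ?_, mono_f := ?_, epi_g := ?_ }⟩
  · rw [ShortComplex.exact_iff_exact_up_to_refinements]
    intro T x hx
    dsimp at x hx ⊢
    obtain ⟨T₁, t₁, _, y, hy⟩ := surjective_up_to_refinements_of_epi (cokernel.π j) x
    have hyq : (y ≫ biprod.snd) ≫ q = 0 := by
      rw [Category.assoc, ← hπg, ← reassoc_of% hy, hx, comp_zero]
    obtain ⟨z, hz⟩ : ∃ z, z ≫ b = y ≫ biprod.snd := ⟨hb.exact.lift _ hyq, hb.exact.lift_f _ _⟩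
    obtain ⟨T₂, t₂, _, e, he⟩ := surjective_up_to_refinements_of_epi S.g z
    refine ⟨T₂, t₂ ≫ t₁, epi_comp _ _, (t₂ ≫ y ≫ biprod.fst - e ≫ h) ≫ p, ?_⟩
    have key : t₂ ≫ y = e ≫ j + (t₂ ≫ y ≫ biprod.fst - e ≫ h) ≫ biprod.inl := by
      ext
      · simp [j]
      · simp [j, ← hz, reassoc_of% he]
    rw [Category.assoc, Category.assoc, hpf, hy, reassoc_of% key]
    simp
  · refine Preadditive.mono_of_cancel_zero _ fun {T} x hx ↦ ?_
    dsimp at x hx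
    obtain ⟨T₁, t₁, _, y, hy⟩ := surjective_up_to_refinements_of_epi p x
    have h1 : (y ≫ biprod.inl) ≫ cokernel.π j = 0 := by
      rw [Category.assoc, ← hpf, ← reassoc_of% hy, hx, comp_zero]
    obtain ⟨T₂, t₂, _, e, he⟩ := hjex.exact_up_to_refinements _ h1
    dsimp at e he
    have he1 : t₂ ≫ y = e ≫ h := by simpa [j] using he =≫ biprod.fst
    have he2 : e ≫ S.g = 0 := by
      rw [← cancel_mono b]
      simpa [j] using (he =≫ biprod.snd).symm
    have h3 : hS.exact.lift e he2 ≫ S.f = e := hS.exact.lift_f _ _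
    rw [← cancel_epi t₁, ← cancel_epi t₂, hy, reassoc_of% he1, ← h3, Category.assoc,
      reassoc_of% hh, w]
    simp
  · have : Epi (cokernel.π j ≫ g) := by
      rw [hπg]
      infer_instance
    exact epi_of_epi (cokernel.π j) g

/-- For a retract `N` of `M` and an embedding of `M` with cokernel `M'`, there is a short exact
sequence `M ⟶ L ⊞ N ⟶ M'` where `L` is the cokernel of the induced embedding of `N`. -/
lemma retract_cokernel {M N P M' : A} (i : N ⟶ M) (r : M ⟶ N) (hir : i ≫ r = 𝟙 N)
    (ι : M ⟶ P) (π : P ⟶ M') (w : ι ≫ π = 0) (hS : (ShortComplex.mk ι π w).ShortExact) :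
    ∃ (f : M ⟶ cokernel (i ≫ ι) ⊞ N) (g : cokernel (i ≫ ι) ⊞ N ⟶ M') (w : f ≫ g = 0),
      (ShortComplex.mk f g w).ShortExact := by
  have : Mono ι := hS.mono_f
  have : Epi π := hS.epi_g
  have : Mono i := mono_of_mono_fac hir
  let c := cokernel.π (i ≫ ι)
  have hc : i ≫ ι ≫ c = 0 := by rw [← Category.assoc, cokernel.condition]
  let d : cokernel (i ≫ ι) ⟶ M' := cokernel.desc (i ≫ ι) π (by simp [w])
  have hcd : c ≫ d = π := cokernel.π_desc _ _ _
  refine ⟨biprod.lift (ι ≫ c) r, biprod.fst ≫ d, by simp [hcd, w],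
    { exact := ?_, mono_f := ?_, epi_g := ?_ }⟩
  · rw [ShortComplex.exact_iff_exact_up_to_refinements]
    intro T x hx
    dsimp at x hx ⊢
    obtain ⟨T₁, t₁, _, y, hy⟩ := surjective_up_to_refinements_of_epi c (x ≫ biprod.fst)
    have hyπ : y ≫ π = 0 := by
      rw [← hcd, ← reassoc_of% hy, hx, comp_zero]
    obtain ⟨m, hm⟩ : ∃ m, m ≫ ι = y := ⟨hS.exact.lift _ hyπ, hS.exact.lift_f _ _⟩
    refine ⟨T₁, t₁, inferInstance, m - m ≫ r ≫ i + t₁ ≫ x ≫ biprod.snd ≫ i, ?_⟩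
    ext
    · simp [hy, hc, reassoc_of% hm]
    · simp [hir]
  · refine Preadditive.mono_of_cancel_zero _ fun {T} x hx ↦ ?_
    dsimp at x hx
    have h1 : (x ≫ ι) ≫ c = 0 := by simpa using hx =≫ biprod.fst
    have h2 : x ≫ r = 0 := by simpa using hx =≫ biprod.snd
    obtain ⟨T₁, t₁, _, n, hn⟩ :=
      (ShortComplex.exact_cokernel (i ≫ ι)).exact_up_to_refinements _ h1
    dsimp at n hn
    have h3 : t₁ ≫ x = n ≫ i := by
      rw [← cancel_mono ι]
      simpa using hn
    have h4 : n = 0 := by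
      rw [← Category.comp_id n, ← hir, ← reassoc_of% h3, h2, comp_zero]
    rw [← cancel_epi t₁, h3, h4, zero_comp, comp_zero]
  · have : Epi (c ≫ d) := by
      rw [hcd]
      infer_instance
    have := epi_of_epi c d
    exact epi_comp _ _

section Coresolution

universe w

variable [HasExt.{w} A]

lemma HasCoresolution.middle {S : ShortComplex A} (hS : S.ShortExact)
    (h₁ : HasCoresolution.{w} S.X₁) (h₃ : HasCoresolution.{w} S.X₃) :
    HasCoresolution.{w} S.X₂ := by
  refine ⟨fun E ↦ ∃ S : ShortComplex A, S.ShortExact ∧ HasCoresolution.{w} S.X₁ ∧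
    HasCoresolution.{w} S.X₃ ∧ S.X₂ = E, ⟨S, hS, h₁, h₃, rfl⟩, ?_⟩
  rintro _ ⟨S, hS, h₁, h₃, rfl⟩
  refine ⟨.middle hS h₁.extVanish h₃.extVanish, ?_⟩
  obtain ⟨X, ⟨P, hP, a, p, wa, ha⟩, hX⟩ := h₁.exists_projStep
  obtain ⟨Y, ⟨Q, hQ, b, q, wb, hb⟩, hY⟩ := h₃.exists_projStep
  obtain ⟨h, hh⟩ := h₃.extVanish.exists_extension hS hP a
  obtain ⟨hj, f, g, wfg, hfg⟩ := horseshoe hS a p wa ha b q wb hb h hh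
  exact ⟨_, ⟨P ⊞ Q, inferInstance, biprod.lift h (S.g ≫ b), cokernel.π _, cokernel.condition _,
    { exact := ShortComplex.exact_cokernel _ }⟩, _, hfg, hX, hY, rfl⟩

lemma HasCoresolution.of_retract {M N : A} (h : HasCoresolution.{w} M) (i : N ⟶ M) (r : M ⟶ N)
    (hir : i ≫ r = 𝟙 N) : HasCoresolution.{w} N := by
  refine ⟨fun N ↦ ∃ (M : A) (_ : HasCoresolution.{w} M) (i : N ⟶ M) (r : M ⟶ N), i ≫ r = 𝟙 N,
    ⟨M, h, i, r, hir⟩, ?_⟩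
  rintro N ⟨M, h, i, r, hir⟩
  refine ⟨h.extVanish.of_retract i r hir, ?_⟩
  obtain ⟨M', ⟨P, hP, ι, π, w, hS⟩, hM'⟩ := h.exists_projStep
  have : Mono ι := hS.mono_f
  have : Mono i := mono_of_mono_fac hir
  obtain ⟨f, g, w', hfg⟩ := retract_cokernel i r hir ι π w hS
  exact ⟨cokernel (i ≫ ι), ⟨P, hP, i ≫ ι, cokernel.π _, cokernel.condition _,
    { exact := ShortComplex.exact_cokernel _ }⟩, _, .middle hfg h hM', biprod.inl, biprod.fst,
    by simp⟩

lemma hasCoresolution_of_isGorensteinProjective {M : A} (hM : IsGorensteinProjective M) :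
    HasCoresolution.{w} M := by
  obtain ⟨K, hK, hex, ⟨e⟩, hQ⟩ := hM
  let T (n : ℤ) : ShortComplex A :=
    ShortComplex.mk (K.iCycles n) (K.toCycles n (n + 1))
      (by rw [← cancel_mono (K.iCycles (n + 1))]; simp)
  have hepi (n : ℤ) : Epi (K.toCycles n (n + 1)) := by
    have h := (K.exactAt_iff' n (n + 1) (n + 1 + 1) (by simp) (by simp)).1 (hex (n + 1))
    rw [epi_iff_surjective_up_to_refinements]
    intro X y
    have hy : (y ≫ K.iCycles (n + 1)) ≫ K.d (n + 1) (n + 1 + 1) = 0 := by simp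
    obtain ⟨X', t, ht, (x : X' ⟶ K.X n), hx⟩ := h.exact_up_to_refinements _ hy
    refine ⟨X', t, ht, x, ?_⟩
    rw [← cancel_mono (K.iCycles (n + 1)), Category.assoc, Category.assoc, K.toCycles_i]
    exact hx
  have hT (n : ℤ) : (T n).ShortExact := by
    have : Mono (T n).f := inferInstanceAs (Mono (K.iCycles n))
    have : Epi (T n).g := hepi n
    refine { exact := ?_ }
    rw [ShortComplex.exact_iff_exact_up_to_refinements]
    intro X x hx
    have hx' : x ≫ K.d n (n + 1) = 0 := by
      have := hx =≫ K.iCycles (n + 1)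
      simpa [T] using this
    exact ⟨X, 𝟙 X, inferInstance, K.liftCycles x (n + 1) (by simp) hx', by simp [T]⟩
  have hext (n : ℤ) (Q : A) (hQ' : Projective Q) (f : K.cycles n ⟶ Q) :
      ∃ g, K.iCycles n ≫ g = f := by
    obtain ⟨m, rfl⟩ : ∃ m, n = m + 1 := ⟨n - 1, by ring⟩
    obtain ⟨g, hg⟩ := hQ Q hQ' m (K.toCycles m (m + 1) ≫ f) (by simp)
    exact ⟨g, by simpa [← cancel_epi (K.toCycles m (m + 1))] using hg⟩
  have hvan (m : ℕ) : ∀ (n : ℤ) (Q : A), Projective Q →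
      ∀ x : Ext.{w} (K.cycles n) Q (m + 1), x = 0 := by
    have hstep (m : ℕ) (k : ℤ) (Q : A) (x : Ext.{w} (K.cycles (k + 1)) Q (m + 1)) :
        ∃ y : Ext.{w} (K.cycles k) Q m, (hT k).extClass.comp y (add_comm _ _) = x :=
      Ext.contravariant_sequence_exact₃ (hT k) Q x
        (Ext.eq_zero_of_projective (P := K.X k) _) (add_comm _ _)
    induction m with
    | zero =>
      intro n Q hQ' x
      obtain ⟨k, rfl⟩ : ∃ k, n = k + 1 := ⟨n - 1, by ring⟩
      obtain ⟨y, rfl⟩ := hstep 0 k Q x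
      obtain ⟨f, rfl⟩ := (Ext.mk₀_bijective _ _).2 y
      obtain ⟨g, rfl⟩ := hext k Q hQ' f
      rw [← Ext.mk₀_comp_mk₀]
      exact (hT k).extClass_comp_assoc _
    | succ m ih =>
      intro n Q hQ' x
      obtain ⟨k, rfl⟩ : ∃ k, n = k + 1 := ⟨n - 1, by ring⟩
      obtain ⟨y, rfl⟩ := hstep (m + 1) k Q x
      rw [ih k Q hQ' y, Ext.comp_zero]
  refine ⟨fun X ↦ ∃ n, Nonempty (X ≅ K.cycles n), ⟨0, ⟨e⟩⟩, ?_⟩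
  rintro X ⟨n, ⟨e⟩⟩
  have hW : ExtVanish.{w} (K.cycles n) := fun Q hQ m ↦ hvan m n Q hQ
  refine ⟨hW.of_retract e.hom e.inv e.hom_inv_id, K.cycles (n + 1), ?_, n + 1, ⟨Iso.refl _⟩⟩
  refine ⟨K.X n, hK n, e.hom ≫ K.iCycles n, K.toCycles n (n + 1), ?_, ?_⟩
  · rw [Category.assoc, (T n).zero, comp_zero]
  · refine ShortComplex.shortExact_of_iso (S₁ := T n) ?_ (hT n)
    exact ShortComplex.isoMk e.symm (Iso.refl _) (Iso.refl _) (by simp [T]) (by simp [T])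

/-- Splicing a bi-infinite sequence of short exact sequences with projective middle terms. -/
lemma isGorensteinProjective_of_chain (Z : ℤ → A) (hZ : ∀ n, ProjStep (Z n) (Z (n + 1)))
    (hW : ∀ n, ExtVanish.{w} (Z n)) : IsGorensteinProjective (Z 0) := by
  choose P hP ι π w hS using hZ
  have hmono (n : ℤ) : Mono (ι n) := (hS n).mono_f
  have hepi (n : ℤ) : Epi (π n) := (hS n).epi_g
  let K : CochainComplex A ℤ := CochainComplex.of P (fun n ↦ π n ≫ ι (n + 1))
    (fun n ↦ by simp [reassoc_of% (w (n + 1))])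
  have hd (n : ℤ) : K.d n (n + 1) = π n ≫ ι (n + 1) :=
    CochainComplex.of_d (X := P) (d := fun n ↦ π n ≫ ι (n + 1)) n
  refine ⟨K, hP, ?_, ?_, ?_⟩
  · intro n
    obtain ⟨m, rfl⟩ : ∃ m, n = m + 1 := ⟨n - 1, by ring⟩
    rw [K.exactAt_iff' m (m + 1) (m + 1 + 1) (by simp) (by simp),
      ShortComplex.exact_iff_exact_up_to_refinements]
    intro T (x : T ⟶ K.X (m + 1)) hx
    change x ≫ K.d (m + 1) (m + 1 + 1) = 0 at hx
    change ∃ (T' : A) (t : T' ⟶ T) (_ : Epi t) (y : T' ⟶ K.X m), t ≫ x = y ≫ K.d m (m + 1)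
    rw [hd, ← Category.assoc] at hx
    have hx' : x ≫ π (m + 1) = 0 := zero_of_comp_mono _ hx
    obtain ⟨z, hz⟩ : ∃ z, z ≫ ι (m + 1) = x :=
      ⟨(hS (m + 1)).exact.lift x hx', (hS (m + 1)).exact.lift_f _ _⟩
    obtain ⟨T', t, ht, y, hy⟩ := surjective_up_to_refinements_of_epi (π m) z
    exact ⟨T', t, ht, y, by rw [hd, ← hz, reassoc_of% hy]⟩
  · exact ⟨IsLimit.conePointUniqueUpToIso
      (isKernelCompMono (hS 0).fIsKernel (ι (0 + 1)) (hd 0)) (K.cyclesIsKernel 0 (0 + 1) (by simp))⟩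
  · intro Q hQ n f hf
    obtain ⟨m, rfl⟩ : ∃ m, n = m + 1 := ⟨n - 1, by ring⟩
    rw [add_sub_cancel_right, hd, Category.assoc] at hf
    have hf' : ι (m + 1) ≫ f = 0 := zero_of_epi_comp _ hf
    obtain ⟨h, hh⟩ : ∃ h, π (m + 1) ≫ h = f :=
      ⟨(hS (m + 1)).exact.desc f hf', (hS (m + 1)).exact.g_desc _ _⟩
    obtain ⟨g, hg⟩ := (hW _).exists_extension (hS (m + 1 + 1)) hQ h
    dsimp at g hg
    exact ⟨g, by rw [hd, Category.assoc, hg, hh]⟩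

end Coresolution

end GorensteinProjective

/-- In an abelian category with enough projectives, a direct summand of a Gorenstein
projective object is Gorenstein projective. -/
theorem isGorensteinProjective_of_directSummand {𝒜 : Type*} [Category 𝒜] [Abelian 𝒜]
    [EnoughProjectives 𝒜] {M N : 𝒜} (hM : IsGorensteinProjective M)
    (i : N ⟶ M) (r : M ⟶ N) (hir : i ≫ r = 𝟙 N) :
    IsGorensteinProjective N := by
  let := HasExt.standard 𝒜
  have hN := (GorensteinProjective.hasCoresolution_of_isGorensteinProjective hM).of_retract i r hir
  obtain ⟨Z, rfl, hZ, hW⟩ := GorensteinProjective.exists_int_chain GorensteinProjective.ProjStep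
    GorensteinProjective.HasCoresolution GorensteinProjective.ExtVanish
    (fun _ h ↦ h.exists_projStep) GorensteinProjective.exists_projStep_left
    (fun _ h ↦ h.extVanish) N hN
  exact GorensteinProjective.isGorensteinProjective_of_chain Z hZ hW
end
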